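/- arXiv:1207.5593 — 6 statements merged into one kernel-verified Lean document; each statement's English description precedes it below -/
import Mathlib

section
/- Let L be a transitive permutation group with point-stabiliser L_ω. Then L is f-graph-restrictive for the function f(n) = |L_ω|^{(n-2)/2}; that is, for every locally-L pair (Γ,G) and every arc (u,v) of Γ, the inequality |G_{uv}| ≤ |L_ω|^{(|V(Γ)|-2)/2} holds. -/
/-- The automorphism group of a simple graph, as a subgroup of the symmetric group
on the vertices. -/
def SimpleGraph.autSubgroup {V : Type*} (Γ : SimpleGraph V) : Subgroup (Equiv.Perm V) where
  carrier := {g : Equiv.Perm V | ∀ u w : V, Γ.Adj (g u) (g w) ↔ Γ.Adj u w}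
  one_mem' := fun u w => Iff.rfl
  mul_mem' := by
    intro a b ha hb u w
    simp only [Equiv.Perm.mul_apply]
    exact (ha _ _).trans (hb _ _)
  inv_mem' := by
    intro a ha u w
    have h := ha (a⁻¹ u) (a⁻¹ w)
    simpa using h.symm

/-- The stabiliser of the point `ω` in the permutation group `L`. -/
def pStab {Ω : Type*} (L : Subgroup (Equiv.Perm Ω)) (ω : Ω) : Subgroup (Equiv.Perm Ω) :=
  L ⊓ MulAction.stabilizer (Equiv.Perm Ω) ω

/-- The stabiliser of the arc `(u,v)` in the group `G`. -/
def aStab {V : Type*} (G : Subgroup (Equiv.Perm V)) (u v : V) : Subgroup (Equiv.Perm V) :=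
  G ⊓ MulAction.stabilizer (Equiv.Perm V) u ⊓ MulAction.stabilizer (Equiv.Perm V) v

/-- A permutation group is transitive. -/
def IsTransPerm {Ω : Type*} (L : Subgroup (Equiv.Perm Ω)) : Prop :=
  ∀ a b : Ω, ∃ g ∈ L, g a = b

/-- `G` acts transitively on the arcs of `Γ`. -/
def IsArcTransitive {V : Type*} (Γ : SimpleGraph V) (G : Subgroup (Equiv.Perm V)) : Prop :=
  ∀ ⦃u v u' v' : V⦄, Γ.Adj u v → Γ.Adj u' v' → ∃ g ∈ G, g u = u' ∧ g v = v'

/-- The permutation group induced on each neighbourhood by the corresponding vertex-stabiliser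
in `G` is permutation isomorphic to `L`. -/
def IsLocally {V Ω : Type*} (Γ : SimpleGraph V) (G : Subgroup (Equiv.Perm V))
    (L : Subgroup (Equiv.Perm Ω)) : Prop :=
  ∀ v : V, ∃ e : Γ.neighborSet v ≃ Ω, ∀ σ : Equiv.Perm Ω,
    σ ∈ L ↔ ∃ g ∈ G, g v = v ∧ ∀ w : Γ.neighborSet v, (e.symm (σ (e w)) : V) = g (w : V)

/-- `(Γ, G)` is a locally-`L` pair. -/
structure IsLocallyPair {V Ω : Type*} (Γ : SimpleGraph V) (G : Subgroup (Equiv.Perm V))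
    (L : Subgroup (Equiv.Perm Ω)) : Prop where
  connected : Γ.Connected
  le_aut : G ≤ Γ.autSubgroup
  arc_trans : IsArcTransitive Γ G
  loc : IsLocally Γ G L

/-- `L` is `f`-graph-restrictive. -/
def FGraphRestrictive {Ω : Type*} (L : Subgroup (Equiv.Perm Ω)) (f : ℕ → ℝ) : Prop :=
  ∀ (V : Type) [Fintype V], ∀ (Γ : SimpleGraph V) (G : Subgroup (Equiv.Perm V)),
    IsLocallyPair Γ G L → ∀ u v : V, Γ.Adj u v →
      (Nat.card ↥(aStab G u v) : ℝ) ≤ f (Fintype.card V)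

/-- `L` is `f`-graph-unrestrictive. -/
def FGraphUnrestrictive {Ω : Type*} (L : Subgroup (Equiv.Perm Ω)) (f : ℕ → ℝ) : Prop :=
  ∀ n : ℕ, ∃ (V : Type) (_ : Fintype V) (Γ : SimpleGraph V) (G : Subgroup (Equiv.Perm V))
    (u v : V), IsLocallyPair Γ G L ∧ n ≤ Fintype.card V ∧ Γ.Adj u v ∧
      f (Fintype.card V) ≤ (Nat.card ↥(aStab G u v) : ℝ)

/-- The pointwise stabiliser of the set `S` in the permutation group `G`. -/
def pointwiseStab {V : Type*} (G : Subgroup (Equiv.Perm V)) (S : Set V) :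
    Subgroup (Equiv.Perm V) :=
  G ⊓ fixingSubgroup (Equiv.Perm V) S

theorem mem_pointwiseStab {V : Type*} {G : Subgroup (Equiv.Perm V)} {S : Set V}
    {g : Equiv.Perm V} : g ∈ pointwiseStab G S ↔ g ∈ G ∧ ∀ x ∈ S, g x = x := by
  simp [pointwiseStab, mem_fixingSubgroup_iff]

/-- Point-stabilisers in a transitive group have the same order. -/
theorem IsTransPerm.card_pStab_eq {Ω : Type*} {L : Subgroup (Equiv.Perm Ω)}
    (hL : IsTransPerm L) (a b : Ω) : Nat.card (pStab L a) = Nat.card (pStab L b) := by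
  obtain ⟨g, hg, rfl⟩ := hL a b
  have : (pStab L a).map (MulAut.conj g).toMonoidHom = pStab L (g a) := by
    ext σ
    simp only [pStab, Subgroup.mem_map, Subgroup.mem_inf, MulAction.mem_stabilizer_iff,
      Equiv.Perm.smul_def, MulEquiv.coe_toMonoidHom, MulAut.conj_apply]
    constructor
    · rintro ⟨τ, ⟨hτ, hfix⟩, rfl⟩
      exact ⟨L.mul_mem (L.mul_mem hg hτ) (L.inv_mem hg), by simp [hfix]⟩
    · rintro ⟨hσ, hfix⟩
      exact ⟨g⁻¹ * σ * g, ⟨L.mul_mem (L.mul_mem (L.inv_mem hg) hσ) hg, by simp [hfix]⟩,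
        by group⟩
  rw [← this, Subgroup.card_map_of_injective (MulAut.conj g).injective]

/-- Enlarging the fixed set by the neighbourhood of a vertex `s`, where `s` and some neighbour
of `s` are already fixed, costs a factor of at most the order of a point-stabiliser in `L`. -/
theorem card_pointwiseStab_le_mul {V Ω : Type*} [Finite V] [Finite Ω] {Γ : SimpleGraph V}
    {G : Subgroup (Equiv.Perm V)} {L : Subgroup (Equiv.Perm Ω)} (hL : IsTransPerm L) (ω : Ω)
    (hpair : IsLocallyPair Γ G L) {S : Set V} {s r : V} (hs : s ∈ S) (hr : r ∈ S)
    (hsr : Γ.Adj s r) :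
    Nat.card (pointwiseStab G S) ≤
      Nat.card (pointwiseStab G (S ∪ Γ.neighborSet s)) * Nat.card (pStab L ω) := by
  obtain ⟨e, he⟩ := hpair.loc s
  have hnbr (h : pointwiseStab G S) (x : V) :
      x ∈ Γ.neighborSet s ↔ (h : Equiv.Perm V) x ∈ Γ.neighborSet s := by
    have hmem := mem_pointwiseStab.1 h.2
    have := hpair.le_aut hmem.1 s x
    rw [hmem.2 s hs] at this
    exact this.symm
  let φ : pointwiseStab G S →* Equiv.Perm (Γ.neighborSet s) :=
    MonoidHom.mk' (fun h => (h : Equiv.Perm V).subtypePerm fun x => (hnbr h x).symm)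
      fun a b => by ext; rfl
  let ψ : pointwiseStab G S →* Equiv.Perm Ω := e.permCongrHom.toMonoidHom.comp φ
  have hψ (h : pointwiseStab G S) (w : Γ.neighborSet s) :
      (e.symm (ψ h (e w)) : V) = (h : Equiv.Perm V) w := by
    simp [ψ, φ, Equiv.permCongrHom]
  have hker : ψ.ker.map (pointwiseStab G S).subtype ≤
      pointwiseStab G (S ∪ Γ.neighborSet s) := by
    rintro _ ⟨h, hh, rfl⟩
    have hmem := mem_pointwiseStab.1 h.2
    refine mem_pointwiseStab.2 ⟨hmem.1, ?_⟩
    rintro x (hx | hx)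
    · exact hmem.2 x hx
    · have h1 := hψ h ⟨x, hx⟩
      rw [MonoidHom.mem_ker.1 hh] at h1
      simpa using h1.symm
  have hrange : ψ.range ≤ pStab L (e ⟨r, hsr⟩) := by
    rintro _ ⟨h, rfl⟩
    have hmem := mem_pointwiseStab.1 h.2
    refine ⟨(he _).2 ⟨h, hmem.1, hmem.2 s hs, hψ h⟩, ?_⟩
    have hfix : ψ h (e ⟨r, hsr⟩) = e ⟨r, hsr⟩ := by
      apply e.symm.injective
      apply Subtype.ext
      rw [hψ, e.symm_apply_apply]
      exact hmem.2 r hr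
    exact hfix
  rw [← ψ.ker.card_mul_index, Subgroup.index_ker, hL.card_pStab_eq ω (e ⟨r, hsr⟩),
    ← Subgroup.card_subtype]
  exact Nat.mul_le_mul (Subgroup.card_le_of_le hker) (Subgroup.card_le_of_le hrange)

/-- If the pointwise stabiliser of `S` moves a neighbour of `s ∈ S`, then `s` has at least two
neighbours outside `S`. -/
theorem ncard_add_two_le {V : Type*} [Finite V] {Γ : SimpleGraph V}
    {G : Subgroup (Equiv.Perm V)} (hG : G ≤ Γ.autSubgroup) {S : Set V} {s t : V} (hs : s ∈ S)
    {h : Equiv.Perm V} (hh : h ∈ pointwiseStab G S) (hst : Γ.Adj s t) (hmove : h t ≠ t) :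
    S.ncard + 2 ≤ (S ∪ Γ.neighborSet s).ncard := by
  obtain ⟨hhG, hfix⟩ := mem_pointwiseStab.1 hh
  have hht : Γ.Adj s (h t) := by
    have := (hG hhG s t).2 hst
    rwa [hfix s hs] at this
  have ht : t ∉ S := fun ht => hmove (hfix t ht)
  have hhtS : h t ∉ insert t S := by
    rintro (h1 | h1)
    · exact hmove h1
    · exact hmove (h.injective (hfix _ h1))
  change S.ncard + 1 + 1 ≤ _
  rw [← Set.ncard_insert_of_notMem ht, ← Set.ncard_insert_of_notMem hhtS]
  refine Set.ncard_le_ncard ?_ (Set.toFinite _)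
  rintro x (rfl | rfl | hx)
  exacts [Or.inr hht, Or.inr hst, Or.inl hx]

/-- If no vertex of the nonempty set `S` is isolated in the subgraph induced on `S`, then the
pointwise stabiliser of `S` has order at most `|L_ω|^{(|V| - |S|)/2}`. -/
theorem card_pointwiseStab_le {V Ω : Type*} [Finite V] [Finite Ω] {Γ : SimpleGraph V}
    {G : Subgroup (Equiv.Perm V)} {L : Subgroup (Equiv.Perm Ω)} (hL : IsTransPerm L) (ω : Ω)
    (hpair : IsLocallyPair Γ G L) (S : Set V) (hne : S.Nonempty)
    (hS : ∀ s ∈ S, ∃ r ∈ S, Γ.Adj s r) :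
    (Nat.card (pointwiseStab G S) : ℝ) ≤
      (Nat.card (pStab L ω) : ℝ) ^ (((Nat.card V : ℝ) - S.ncard) / 2) := by
  have hc : (1 : ℝ) ≤ Nat.card (pStab L ω) := by exact_mod_cast Nat.card_pos
  by_cases hV : S = Set.univ
  · have hbot : pointwiseStab G S = ⊥ := by
      rw [eq_bot_iff]
      intro g hg
      ext x
      simpa using (mem_pointwiseStab.1 hg).2 x (hV ▸ Set.mem_univ x)
    rw [hbot, hV]
    simp [Set.ncard_univ]
  obtain ⟨y, hy⟩ := (Set.ne_univ_iff_exists_notMem S).1 hV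
  obtain ⟨x, hx⟩ := hne
  obtain ⟨p⟩ := hpair.connected.preconnected x y
  obtain ⟨d, -, hs, ht⟩ := p.exists_boundary_dart S hx hy
  obtain ⟨s, hs_eq⟩ : ∃ s, s = d.fst := ⟨_, rfl⟩
  rw [← hs_eq] at hs
  have hadj : Γ.Adj s d.snd := hs_eq ▸ d.adj
  have hlt : S.ncard < (S ∪ Γ.neighborSet s).ncard :=
    Set.ncard_lt_ncard (Set.ssubset_iff_of_subset Set.subset_union_left |>.2
      ⟨d.snd, Or.inr hadj, ht⟩)
  have hle : (S ∪ Γ.neighborSet s).ncard ≤ Nat.card V := Set.ncard_le_card _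
  have ih := card_pointwiseStab_le hL ω hpair (S ∪ Γ.neighborSet s) ⟨x, Or.inl hx⟩ (by
    rintro z (hz | hz)
    · obtain ⟨r, hr, hzr⟩ := hS z hz
      exact ⟨r, Or.inl hr, hzr⟩
    · exact ⟨s, Or.inl hs, hz.symm⟩)
  by_cases hmove : ∃ h ∈ pointwiseStab G S, ∃ t, Γ.Adj s t ∧ h t ≠ t
  · obtain ⟨h, hh, t, hst, hht⟩ := hmove
    have htwo := ncard_add_two_le hpair.le_aut hs hh hst hht
    obtain ⟨r, hr, hsr⟩ := hS s hs
    calc (Nat.card (pointwiseStab G S) : ℝ)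
        ≤ Nat.card (pointwiseStab G (S ∪ Γ.neighborSet s)) * Nat.card (pStab L ω) := by
          exact_mod_cast card_pointwiseStab_le_mul hL ω hpair hs hr hsr
      _ ≤ (Nat.card (pStab L ω) : ℝ) ^
            (((Nat.card V : ℝ) - (S ∪ Γ.neighborSet s).ncard) / 2) * Nat.card (pStab L ω) := by
          gcongr
      _ = (Nat.card (pStab L ω) : ℝ) ^
            (((Nat.card V : ℝ) - (S ∪ Γ.neighborSet s).ncard) / 2 + 1) := by
          rw [Real.rpow_add_one (by positivity)]
      _ ≤ _ := by
          apply Real.rpow_le_rpow_of_exponent_le hc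
          have : (S.ncard : ℝ) + 2 ≤ (S ∪ Γ.neighborSet s).ncard := by exact_mod_cast htwo
          linarith
  · push Not at hmove
    have hle' : pointwiseStab G S ≤ pointwiseStab G (S ∪ Γ.neighborSet s) := by
      intro h hh
      obtain ⟨hhG, hfix⟩ := mem_pointwiseStab.1 hh
      refine mem_pointwiseStab.2 ⟨hhG, ?_⟩
      rintro z (hz | hz)
      exacts [hfix z hz, hmove h hh z hz]
    calc (Nat.card (pointwiseStab G S) : ℝ)
        ≤ Nat.card (pointwiseStab G (S ∪ Γ.neighborSet s)) := by
          exact_mod_cast Subgroup.card_le_of_le hle'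
      _ ≤ _ := ih
      _ ≤ _ := by
          apply Real.rpow_le_rpow_of_exponent_le hc
          have : (S.ncard : ℝ) ≤ (S ∪ Γ.neighborSet s).ncard := by exact_mod_cast hlt.le
          linarith
termination_by Nat.card V - S.ncard
decreasing_by omega

/-- Every transitive permutation group `L` is `f`-graph-restrictive for
`f(n) = |L_ω|^{(n-2)/2}`. -/
theorem statement0 {Ω : Type} [Fintype Ω] (L : Subgroup (Equiv.Perm Ω))
    (hL : IsTransPerm L) (ω : Ω)
    (V : Type) [Fintype V] (Γ : SimpleGraph V) (G : Subgroup (Equiv.Perm V))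
    (hpair : IsLocallyPair Γ G L) (u v : V) (huv : Γ.Adj u v) :
    (Nat.card ↥(aStab G u v) : ℝ) ≤
      (Nat.card ↥(pStab L ω) : ℝ) ^ (((Fintype.card V : ℝ) - 2) / 2) := by
  have hle : aStab G u v ≤ pointwiseStab G {u, v} := by
    rintro g ⟨⟨hg, hu⟩, hv⟩
    refine mem_pointwiseStab.2 ⟨hg, ?_⟩
    rintro x (rfl | rfl)
    exacts [hu, hv]
  have hmain := card_pointwiseStab_le hL ω hpair {u, v} ⟨u, Or.inl rfl⟩ (by
    rintro x (rfl | rfl)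
    exacts [⟨v, Or.inr rfl, huv⟩, ⟨u, Or.inl rfl, huv.symm⟩])
  rw [Set.ncard_pair huv.ne, Nat.card_eq_fintype_card (α := V)] at hmain
  exact le_trans (by exact_mod_cast Subgroup.card_le_of_le hle) hmain
end

section
/- Let L be a transitive permutation group with non-trivial point-stabiliser L_ω and let p be the smallest prime dividing |L_ω|. Then for every locally-L pair (Γ,G) and every arc (u,v) of Γ, the inequality |G_{uv}| ≤ |L_ω|^{(|V(Γ)|-2)/p} holds. -/
/-- A subgroup fixing the vertex `x` acts on the neighbourhood of `x`; the action is transported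
along `e`. -/
theorem exists_hom_neighborSet {V Ω : Type*} {Γ : SimpleGraph V} {H : Subgroup (Equiv.Perm V)}
    (hH : H ≤ Γ.autSubgroup) {x : V} (hx : ∀ h ∈ H, h x = x) (e : Γ.neighborSet x ≃ Ω) :
    ∃ φ : H →* Equiv.Perm Ω, ∀ (h : H) (w : Γ.neighborSet x),
      (e.symm (φ h (e w)) : V) = (h : Equiv.Perm V) w := by
  have key : ∀ (h : H) (w : V),
      (h : Equiv.Perm V) w ∈ Γ.neighborSet x ↔ w ∈ Γ.neighborSet x := by
    intro h w
    have := hH h.2 x w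
    rwa [hx h h.2] at this
  refine ⟨{ toFun := fun h => e.permCongr ((h : Equiv.Perm V).subtypePerm (key h))
            map_one' := ?_
            map_mul' := ?_ }, ?_⟩
  · ext a
    simp
  · intro a b
    ext c
    simp [Equiv.Perm.subtypePerm]
  · intro h w
    simp

/-- A proper non-empty vertex set of a connected graph has an edge leaving it. -/
theorem SimpleGraph.Connected.exists_adj_mem_notMem {V : Type*} {Γ : SimpleGraph V}
    (hΓ : Γ.Connected) {S : Set V} (hne : S.Nonempty) (huniv : S ≠ Set.univ) :
    ∃ x ∈ S, ∃ y ∉ S, Γ.Adj x y := by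
  obtain ⟨a, ha⟩ := hne
  obtain ⟨b, hb⟩ := (Set.ne_univ_iff_exists_notMem S).1 huniv
  obtain ⟨w⟩ := hΓ.preconnected a b
  obtain ⟨d, -, h1, h2⟩ := w.exists_boundary_dart S ha hb
  exact ⟨d.fst, h1, d.snd, h2, d.adj⟩

/-- A non-trivial orbit of a finite permutation group has at least `p` points, if all prime
divisors of the group order are at least `p`. -/
theorem le_ncard_orbit {Ω : Type*} [Finite Ω] (R : Subgroup (Equiv.Perm Ω)) {p : ℕ}
    (hR : ∀ q : ℕ, q.Prime → q ∣ Nat.card R → p ≤ q) {a : Ω} {r : Equiv.Perm Ω} (hr : r ∈ R)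
    (hra : r a ≠ a) : p ≤ (MulAction.orbit R a).ncard := by
  have hcard : (MulAction.orbit R a).ncard ∣ Nat.card R := by
    rw [← MulAction.index_stabilizer]
    exact Subgroup.index_dvd_card _
  have hne : (MulAction.orbit R a).ncard ≠ 1 := by
    intro h
    obtain ⟨b, hb⟩ := Set.ncard_eq_one.1 h
    have h1 : r a ∈ MulAction.orbit R a := ⟨⟨r, hr⟩, rfl⟩
    have h2 : a ∈ MulAction.orbit R a := MulAction.mem_orbit_self a
    rw [hb] at h1 h2
    exact hra (h1.trans h2.symm)
  have hpos : 0 < (MulAction.orbit R a).ncard :=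
    (Set.ncard_pos (Set.toFinite _)).2 ⟨a, MulAction.mem_orbit_self a⟩
  exact (hR _ (Nat.minFac_prime hne) ((Nat.minFac_dvd _).trans hcard)).trans
    (Nat.minFac_le hpos)

/-- If `H ≤ G` fixes pointwise a set `S` inducing a subgraph without isolated vertices, then
`|H| ^ p ≤ |L_ω| ^ |V \ S|`. -/
theorem IsLocallyPair.card_pow_le {V Ω : Type*} [Finite V] [Finite Ω] {Γ : SimpleGraph V}
    {G : Subgroup (Equiv.Perm V)} {L : Subgroup (Equiv.Perm Ω)} (hpair : IsLocallyPair Γ G L)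
    (hL : IsTransPerm L) (ω : Ω) {p : ℕ}
    (hmin : ∀ q : ℕ, q.Prime → q ∣ Nat.card (pStab L ω) → p ≤ q)
    (H : Subgroup (Equiv.Perm V)) (hHG : H ≤ G) (S : Set V) (hS : S.Nonempty)
    (hadj : ∀ x ∈ S, ∃ z ∈ S, Γ.Adj x z) (hfix : ∀ h ∈ H, ∀ x ∈ S, h x = x) :
    Nat.card H ^ p ≤ Nat.card (pStab L ω) ^ Sᶜ.ncard := by
  induction hn : Sᶜ.ncard using Nat.strong_induction_on generalizing H S with
  | _ n ih =>
  subst hn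
  by_cases huniv : S = Set.univ
  · have : H = ⊥ := by
      rw [Subgroup.eq_bot_iff_forall]
      intro h hh
      ext x
      exact hfix h hh x (huniv ▸ Set.mem_univ x)
    subst this
    simp [huniv]
  obtain ⟨x, hxS, y, hyS, hxy⟩ := hpair.connected.exists_adj_mem_notMem hS huniv
  obtain ⟨z, hzS, hxz⟩ := hadj x hxS
  obtain ⟨e, he⟩ := hpair.loc x
  obtain ⟨φ, hφ⟩ := exists_hom_neighborSet (hHG.trans hpair.le_aut)
    (fun h hh => hfix h hh x hxS) e
  have hrange : φ.range ≤ pStab L (e ⟨z, hxz⟩) := by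
    rintro _ ⟨h, rfl⟩
    refine Subgroup.mem_inf.2 ⟨(he _).2 ⟨h, hHG h.2, hfix h h.2 x hxS, hφ h⟩, ?_⟩
    rw [MulAction.mem_stabilizer_iff, Equiv.Perm.smul_def, ← Equiv.symm_apply_eq]
    exact Subtype.ext ((hφ h ⟨z, hxz⟩).trans (hfix h h.2 z hzS))
  have hdvd : Nat.card φ.range ∣ Nat.card (pStab L ω) := by
    rw [hL.card_pStab_eq ω (e ⟨z, hxz⟩)]
    exact Subgroup.card_dvd_of_le hrange
  have hpos : 0 < Nat.card (pStab L ω) := Nat.card_pos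
  set S' : Set V := S ∪ Γ.neighborSet x with hS'
  set K : Subgroup (Equiv.Perm V) := φ.ker.map H.subtype with hK
  have hcard : Nat.card H = Nat.card φ.range * Nat.card K := by
    rw [hK, Subgroup.card_map_of_injective H.subtype_injective, ← Subgroup.index_ker,
      Subgroup.index_mul_card]
  have hlt : S'ᶜ.ncard < Sᶜ.ncard := by
    refine Set.ncard_lt_ncard ?_
    rw [Set.ssubset_iff_of_subset (Set.compl_subset_compl.2 Set.subset_union_left)]
    exact ⟨y, hyS, fun h => h (Or.inr hxy)⟩
  have hKle : Nat.card K ^ p ≤ Nat.card (pStab L ω) ^ S'ᶜ.ncard := by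
    refine ih _ hlt K ((Subgroup.map_subtype_le _).trans hHG) S' (hS.mono Set.subset_union_left)
      ?_ ?_ rfl
    · rintro a (ha | ha)
      · obtain ⟨b, hb, hab⟩ := hadj a ha
        exact ⟨b, Or.inl hb, hab⟩
      · exact ⟨x, Or.inl hxS, (show Γ.Adj x a from ha).symm⟩
    · rintro _ ⟨h, hh, rfl⟩ a (ha | ha)
      · exact hfix h h.2 a ha
      · have := hφ h ⟨a, ha⟩
        rw [MonoidHom.mem_ker.1 hh] at this
        simpa using this.symm
  by_cases htriv : φ.range = ⊥
  · rw [hcard, htriv, Subgroup.card_bot, one_mul]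
    exact hKle.trans (Nat.pow_le_pow_right hpos hlt.le)
  obtain ⟨_, ⟨h, rfl⟩, hne⟩ := φ.range.bot_or_exists_ne_one.resolve_left htriv
  obtain ⟨a, ha⟩ : ∃ a, φ h a ≠ a := by
    by_contra! hcon
    exact hne (Equiv.ext hcon)
  have horb : p ≤ (MulAction.orbit φ.range a).ncard :=
    le_ncard_orbit φ.range (fun q hq hqd => hmin q hq (hqd.trans hdvd)) ⟨h, rfl⟩ ha
  set T : Set V := (fun b => (e.symm b : V)) '' MulAction.orbit φ.range a with hT
  have hTcard : T.ncard = (MulAction.orbit φ.range a).ncard :=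
    Set.ncard_image_of_injective _ (Subtype.val_injective.comp e.symm.injective)
  have hTS : T ⊆ Sᶜ := by
    rintro _ ⟨b, hb, rfl⟩ hbS
    have hfixb : ∀ k : H, φ k b = b := by
      intro k
      rw [← e.symm.injective.eq_iff]
      have := hφ k (e.symm b)
      rw [e.apply_symm_apply, hfix k k.2 _ hbS] at this
      exact Subtype.ext this
    obtain ⟨⟨_, k, rfl⟩, hk⟩ := MulAction.mem_orbit_symm.1 hb
    have hab : a = b := hk.symm.trans (hfixb k)
    exact ha (hab ▸ hfixb h)
  have hTS' : Disjoint S'ᶜ T := by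
    rw [Set.disjoint_left]
    rintro _ hb ⟨b, -, rfl⟩
    exact hb (Or.inr (e.symm b).2)
  have hsum : p + S'ᶜ.ncard ≤ Sᶜ.ncard := by
    have := Set.ncard_le_ncard
      (Set.union_subset (Set.compl_subset_compl.2 (Set.subset_union_left (t := Γ.neighborSet x)))
        hTS)
    rw [← hS', Set.ncard_union_eq hTS', hTcard] at this
    omega
  calc Nat.card H ^ p = Nat.card φ.range ^ p * Nat.card K ^ p := by rw [hcard, mul_pow]
    _ ≤ Nat.card (pStab L ω) ^ p * Nat.card (pStab L ω) ^ S'ᶜ.ncard :=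
      Nat.mul_le_mul (Nat.pow_le_pow_left (Nat.le_of_dvd hpos hdvd) p) hKle
    _ = Nat.card (pStab L ω) ^ (p + S'ᶜ.ncard) := (pow_add _ _ _).symm
    _ ≤ Nat.card (pStab L ω) ^ Sᶜ.ncard := Nat.pow_le_pow_right hpos hsum


/-- If `L` is a transitive permutation group with non-trivial point-stabiliser
`L_ω` and `p` is the smallest prime dividing `|L_ω|`, then for every locally-`L` pair `(Γ,G)`
and every arc `(u,v)` of `Γ` one has `|G_{uv}| ≤ |L_ω|^{(|V(Γ)|-2)/p}`. -/
theorem statement1 {Ω : Type} [Fintype Ω] (L : Subgroup (Equiv.Perm Ω))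
    (hL : IsTransPerm L) (ω : Ω) (hnt : pStab L ω ≠ ⊥)
    (p : ℕ) (hp : p.Prime) (hdvd : p ∣ Nat.card ↥(pStab L ω))
    (hmin : ∀ q : ℕ, q.Prime → q ∣ Nat.card ↥(pStab L ω) → p ≤ q)
    (V : Type) [Fintype V] (Γ : SimpleGraph V) (G : Subgroup (Equiv.Perm V))
    (hpair : IsLocallyPair Γ G L) (u v : V) (huv : Γ.Adj u v) :
    (Nat.card ↥(aStab G u v) : ℝ) ≤
      (Nat.card ↥(pStab L ω) : ℝ) ^ (((Fintype.card V : ℝ) - 2) / (p : ℝ)) := by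
  have huv' : u ≠ v := huv.ne
  have hpow := hpair.card_pow_le hL ω hmin (aStab G u v) (inf_le_left.trans inf_le_left) {u, v}
    ⟨u, Or.inl rfl⟩
    (by
      rintro x (rfl | rfl)
      · exact ⟨v, Or.inr rfl, huv⟩
      · exact ⟨u, Or.inl rfl, huv.symm⟩)
    (by
      rintro h ⟨⟨-, hu⟩, hv⟩ x (rfl | rfl)
      · exact hu
      · exact hv)
  have hcard : (({u, v} : Set V)ᶜ.ncard : ℝ) = (Fintype.card V : ℝ) - 2 := by
    have := Set.ncard_add_ncard_compl ({u, v} : Set V)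
    rw [Set.ncard_pair huv', Nat.card_eq_fintype_card] at this
    rw [← this]
    push_cast
    ring
  have hm : (0 : ℝ) ≤ Nat.card (pStab L ω) := Nat.cast_nonneg _
  have hp0 : (p : ℝ) ≠ 0 := Nat.cast_ne_zero.2 hp.ne_zero
  refine le_of_pow_le_pow_left₀ hp.ne_zero (Real.rpow_nonneg hm _) ?_
  rw [← Real.rpow_natCast ((Nat.card (pStab L ω) : ℝ) ^ _), ← Real.rpow_mul hm,
    div_mul_cancel₀ _ hp0, ← hcard, Real.rpow_natCast]
  exact_mod_cast hpow
end

section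
/- Every transitive permutation group L is Exp-graph-restrictive: there exists a real number α > 1 such that for every locally-L pair (Γ,G) and every arc (u,v) of Γ, the inequality |G_{uv}| ≤ α^{|V(Γ)|} holds. -/
/-- In a connected graph, every vertex other than `u` has a neighbour closer to `u`. -/
theorem SimpleGraph.Connected.exists_adj_dist_lt {V : Type*} {Γ : SimpleGraph V}
    (hΓ : Γ.Connected) {u w : V} (hw : w ≠ u) :
    ∃ p, Γ.Adj p w ∧ Γ.dist p u < Γ.dist w u := by
  obtain ⟨q, hq⟩ := hΓ.exists_walk_length_eq_dist w u
  cases q with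
  | nil => exact absurd rfl hw
  | cons h q =>
    refine ⟨_, h.symm, ?_⟩
    have := SimpleGraph.dist_le q
    rw [SimpleGraph.Walk.length_cons] at hq
    omega

/-- If every neighbourhood of a connected graph embeds in `Ω`, then a group of automorphisms fixing
a vertex has order at most `(|Ω| + 1) ^ |V|`. -/
theorem SimpleGraph.Connected.card_le_of_fixed_vertex {V Ω : Type*} [Fintype V] [Fintype Ω]
    {Γ : SimpleGraph V} (hΓ : Γ.Connected) (e : ∀ v, Γ.neighborSet v ↪ Ω)
    {H : Subgroup (Equiv.Perm V)} (hH : H ≤ Γ.autSubgroup) {u : V} (hu : ∀ g ∈ H, g u = u) :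
    Nat.card H ≤ (Fintype.card Ω + 1) ^ Fintype.card V := by
  classical
  have hp : ∀ w, ∃ p, w ≠ u → Γ.Adj p w ∧ Γ.dist p u < Γ.dist w u := by
    intro w
    by_cases hw : w = u
    · exact ⟨u, fun h => absurd hw h⟩
    · obtain ⟨p, h⟩ := hΓ.exists_adj_dist_lt hw
      exact ⟨p, fun _ => h⟩
  choose p hp using hp
  let code (g : H) (w : V) : Option Ω :=
    if h : Γ.Adj (g.1 (p w)) (g.1 w) then some (e (g.1 (p w)) ⟨g.1 w, h⟩) else none
  have hcode : Function.Injective code := by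
    intro g h hgh
    have key : ∀ n w, Γ.dist w u = n → g.1 w = h.1 w := by
      intro n
      induction n using Nat.strong_induction_on with
      | _ n ih =>
        intro w hn
        by_cases hw : w = u
        · rw [hw, hu _ g.2, hu _ h.2]
        · obtain ⟨hadj, hlt⟩ := hp w hw
          have hpar : g.1 (p w) = h.1 (p w) := ih _ (hn ▸ hlt) _ rfl
          have hg : Γ.Adj (g.1 (p w)) (g.1 w) := (hH g.2 _ _).2 hadj
          have hh : Γ.Adj (h.1 (p w)) (h.1 w) := (hH h.2 _ _).2 hadj
          have hc := congrFun hgh w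
          simp only [code, dif_pos hg, dif_pos hh, Option.some.injEq] at hc
          revert hg hh hc
          rw [hpar]
          intro hg hh hc
          exact congrArg Subtype.val ((e _).injective hc)
    exact Subtype.ext (Equiv.ext fun w => key _ w rfl)
  calc Nat.card H ≤ Nat.card (V → Option Ω) := Nat.card_le_card_of_injective code hcode
    _ = _ := by simp [Nat.card_eq_fintype_card]

/-- Every transitive permutation group is Exp-graph-restrictive: there is
`α > 1` bounding every arc-stabiliser of a locally-`L` pair by `α^{|V(Γ)|}`. -/
theorem statement2 {Ω : Type} [Fintype Ω] (L : Subgroup (Equiv.Perm Ω))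
    (hL : IsTransPerm L) :
    ∃ α : ℝ, 1 < α ∧ FGraphRestrictive L (fun n => α ^ n) := by
  refine ⟨Fintype.card Ω + 2, by linarith [(Fintype.card Ω).cast_nonneg (α := ℝ)], ?_⟩
  intro V _ Γ G hG u v _
  choose e _ using hG.loc
  have h : Nat.card (aStab G u v) ≤ (Fintype.card Ω + 1) ^ Fintype.card V :=
    hG.connected.card_le_of_fixed_vertex (fun v => (e v).toEmbedding)
      (fun g hg => hG.le_aut hg.1.1) fun g hg => hg.1.2
  calc (Nat.card (aStab G u v) : ℝ) ≤ ((Fintype.card Ω : ℝ) + 1) ^ Fintype.card V := by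
        exact_mod_cast h
    _ ≤ ((Fintype.card Ω : ℝ) + 2) ^ Fintype.card V := by gcongr; norm_num
end

section
/- For every positive integer m there exists a connected cubic graph of order 6·2^{2m} whose F₂-nullity is at least 4·2^m, which admits an arc-regular group of automorphisms H and a 2-arc-regular group of automorphisms G with H ≤ G. -/
open scoped Classical in
/-- The `F`-nullspace of a finite graph `Γ`: the subspace of all `x : V → F` such that the
values of `x` sum to zero over every neighbourhood. -/
noncomputable def nullspace {V : Type*} [Fintype V] (F : Type*) [Field F]
    (Γ : SimpleGraph V) : Submodule F (V → F) where
  carrier := {x | ∀ v : V, ∑ u : Γ.neighborSet v, x u = 0}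
  zero_mem' := fun v => by simp
  add_mem' := by
    intro x y hx hy v
    simp only [Pi.add_apply, Finset.sum_add_distrib, hx v, hy v, add_zero]
  smul_mem' := by
    intro c x hx v
    simp only [Pi.smul_apply, smul_eq_mul, ← Finset.mul_sum, hx v, mul_zero]

/-- `H` acts regularly (sharply transitively) on the arcs of `Γ`. -/
def IsArcRegular {V : Type*} (Γ : SimpleGraph V) (H : Subgroup (Equiv.Perm V)) : Prop :=
  ∀ ⦃u v u' v' : V⦄, Γ.Adj u v → Γ.Adj u' v' →
    ∃! g : Equiv.Perm V, g ∈ H ∧ g u = u' ∧ g v = v'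

/-- `G` acts regularly (sharply transitively) on the 2-arcs of `Γ`. -/
def Is2ArcRegular {V : Type*} (Γ : SimpleGraph V) (G : Subgroup (Equiv.Perm V)) : Prop :=
  ∀ ⦃u v w u' v' w' : V⦄, Γ.Adj u v → Γ.Adj v w → u ≠ w →
    Γ.Adj u' v' → Γ.Adj v' w' → u' ≠ w' →
      ∃! g : Equiv.Perm V, g ∈ G ∧ g u = u' ∧ g v = v' ∧ g w = w'

namespace Honeycomb

/-- The triangular lattice `ℤ²` modulo `3n`. The unit vectors in three directions at mutual angles
`2π/3` are `(1, 0)`, `(0, 1)` and `(-1, -1)`. -/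
abbrev Lattice (n : ℕ) : Type := ZMod (3 * n) × ZMod (3 * n)

variable {n : ℕ}

/-- The proper `3`-colouring of the triangular lattice. -/
def colour : Lattice n →+ ZMod 3 :=
  (ZMod.castHom (dvd_mul_right 3 n) (ZMod 3)).toAddMonoidHom.coprod
    (ZMod.castHom (dvd_mul_right 3 n) (ZMod 3)).toAddMonoidHom

/-- The three unit steps. -/
def step : Fin 3 → Lattice n := ![(1, 0), (0, 1), (-1, -1)]

/-- The six nonzero vectors of minimal length. -/
def IsUnitStep (z : Lattice n) : Prop := (∃ i, z = step i) ∨ ∃ i, z = -step i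

/-- Vertices of the honeycomb: the points of the triangular lattice not coloured `2`. -/
abbrev Vertex (n : ℕ) : Type := {x : Lattice n // colour x ≠ 2}

@[simp] lemma colour_step (i : Fin 3) : colour (step i : Lattice n) = 1 := by
  fin_cases i
  · simp [colour, step]
  · simp [colour, step]
  · simp only [colour, step]
    simp
    decide

lemma sum_step : (step 0 : Lattice n) + step 1 + step 2 = 0 := by
  simp [step]

lemma isUnitStep_neg {z : Lattice n} : IsUnitStep (-z) ↔ IsUnitStep z := by
  simp only [IsUnitStep, neg_eq_iff_eq_neg, neg_neg]
  exact or_comm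

lemma not_isUnitStep_zero : ¬ IsUnitStep (0 : Lattice n) := by
  rintro (⟨i, h⟩ | ⟨i, h⟩)
  · have := congrArg colour h
    simp at this
  · have := congrArg colour h
    simp at this

lemma step_injective [NeZero n] : Function.Injective (step : Fin 3 → Lattice n) := by
  have : Fact (1 < 3 * n) := ⟨by have := NeZero.pos n; omega⟩
  intro i j h
  fin_cases i <;> fin_cases j <;> simp_all [step]

/-- The honeycomb graph on a torus. -/
def graph (n : ℕ) : SimpleGraph (Vertex n) where
  Adj x y := IsUnitStep (x.1 - y.1)
  symm := ⟨fun x y h => by rwa [← isUnitStep_neg, neg_sub]⟩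
  loopless := ⟨fun x h => not_isUnitStep_zero (by simpa using h)⟩

lemma adj_iff {x y : Vertex n} : (graph n).Adj x y ↔ IsUnitStep (x.1 - y.1) := Iff.rfl

lemma colour_eq (v : Vertex n) : colour v.1 = 0 ∨ colour v.1 = 1 := by
  have h := v.2
  generalize colour v.1 = c at h ⊢
  revert h c
  decide

lemma adj_iff_of_colour_zero {v w : Vertex n} (hv : colour v.1 = 0) :
    (graph n).Adj v w ↔ ∃ i, w.1 = v.1 + step i := by
  constructor
  · rintro (⟨i, h⟩ | ⟨i, h⟩)
    · have := congrArg colour h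
      have hw := w.2
      rw [map_sub, hv, colour_step] at this
      refine absurd ?_ hw
      generalize colour w.1 = c at this ⊢
      revert this c
      decide
    · exact ⟨i, by rw [← neg_eq_iff_eq_neg] at h; rw [← h]; abel⟩
  · rintro ⟨i, h⟩
    exact Or.inr ⟨i, by rw [h]; abel⟩

lemma adj_iff_of_colour_one {v w : Vertex n} (hv : colour v.1 = 1) :
    (graph n).Adj v w ↔ ∃ i, w.1 = v.1 - step i := by
  constructor
  · rintro (⟨i, h⟩ | ⟨i, h⟩)
    · exact ⟨i, by rw [← h]; abel⟩
    · have := congrArg colour h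
      have hw := w.2
      rw [map_sub, hv, map_neg, colour_step] at this
      refine absurd ?_ hw
      generalize colour w.1 = c at this ⊢
      revert this c
      decide
  · rintro ⟨i, h⟩
    exact Or.inl ⟨i, by rw [h]; abel⟩

/-- The three neighbours of a vertex. -/
lemma exists_neighborEquiv [NeZero n] (v : Vertex n) :
    ∃ e : Fin 3 ≃ (graph n).neighborSet v,
      (colour v.1 = 0 ∧ ∀ i, (e i).1.1 = v.1 + step i) ∨
      (colour v.1 = 1 ∧ ∀ i, (e i).1.1 = v.1 - step i) := by
  rcases colour_eq v with hv | hv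
  · have hc (i : Fin 3) : colour (v.1 + step i) ≠ 2 := by
      rw [map_add, hv, colour_step]; decide
    let f : Fin 3 → (graph n).neighborSet v := fun i =>
      ⟨⟨v.1 + step i, hc i⟩, (adj_iff_of_colour_zero hv).2 ⟨i, rfl⟩⟩
    have hf : Function.Bijective f := by
      constructor
      · intro i j h
        exact step_injective (add_left_cancel (congrArg (fun z => z.1.1) h))
      · rintro ⟨w, hw⟩
        obtain ⟨i, hi⟩ := (adj_iff_of_colour_zero hv).1 hw
        exact ⟨i, Subtype.ext (Subtype.ext hi.symm)⟩
    exact ⟨Equiv.ofBijective f hf, Or.inl ⟨hv, fun i => rfl⟩⟩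
  · have hc (i : Fin 3) : colour (v.1 - step i) ≠ 2 := by
      rw [map_sub, hv, colour_step]; decide
    let f : Fin 3 → (graph n).neighborSet v := fun i =>
      ⟨⟨v.1 - step i, hc i⟩, (adj_iff_of_colour_one hv).2 ⟨i, rfl⟩⟩
    have hf : Function.Bijective f := by
      constructor
      · intro i j h
        exact step_injective (sub_right_injective (congrArg (fun z => z.1.1) h))
      · rintro ⟨w, hw⟩
        obtain ⟨i, hi⟩ := (adj_iff_of_colour_one hv).1 hw
        exact ⟨i, Subtype.ext (Subtype.ext hi.symm)⟩
    exact ⟨Equiv.ofBijective f hf, Or.inr ⟨hv, fun i => rfl⟩⟩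

lemma card_neighborSet [NeZero n] (v : Vertex n) :
    Nat.card ((graph n).neighborSet v) = 3 := by
  obtain ⟨e, -⟩ := exists_neighborEquiv v
  simpa using (Nat.card_congr e).symm

lemma card_vertex [NeZero n] : Nat.card (Vertex n) = 6 * n ^ 2 := by
  classical
  have hsucc (c : ZMod 3) : Fintype.card {x : Lattice n // colour x = c} =
      Fintype.card {x : Lattice n // colour x = c + 1} :=
    Fintype.card_congr ((Equiv.addRight (step 0)).subtypeEquiv fun x => by simp)
  have h0 := hsucc 0
  have h1 := hsucc 1
  rw [zero_add] at h0
  rw [one_add_one_eq_two] at h1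
  have hsum : ∑ c : ZMod 3, Fintype.card {x : Lattice n // colour x = c} = 9 * n ^ 2 := by
    rw [← Fintype.card_sigma, Fintype.card_congr (Equiv.sigmaFiberEquiv _), Fintype.card_prod,
      ZMod.card]
    ring
  have hcompl := Fintype.card_subtype_compl (fun x : Lattice n => colour x = 2)
  rw [Fintype.card_prod, ZMod.card] at hcompl
  change ∑ c : Fin 3, _ = _ at hsum
  rw [Fin.sum_univ_three] at hsum
  change Fintype.card {x : Lattice n // colour x = 0} + Fintype.card {x : Lattice n // colour x = 1}
    + Fintype.card {x : Lattice n // colour x = 2} = _ at hsum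
  have : 3 * n * (3 * n) = 9 * n ^ 2 := by ring
  rw [Nat.card_eq_fintype_card, hcompl]
  omega

section Connected

/-- The vertex at the origin. -/
def origin : Vertex n := ⟨0, by rw [map_zero]; decide⟩

lemma reachable_add_step_sub_step {v w : Vertex n} (hv : colour v.1 = 0) (i j : Fin 3)
    (h : w.1 = v.1 + (step i - step j)) : (graph n).Reachable v w := by
  have hc : colour (v.1 + step i) = 1 := by simp [hv]
  let u : Vertex n := ⟨v.1 + step i, by rw [hc]; decide⟩
  have hvu : (graph n).Adj v u := (adj_iff_of_colour_zero hv).2 ⟨i, rfl⟩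
  have huw : (graph n).Adj u w := (adj_iff_of_colour_one hc).2 ⟨j, by rw [h]; simp [u]; abel⟩
  exact hvu.reachable.trans huw.reachable

lemma reachable_add_nsmul {v w : Vertex n} (hv : colour v.1 = 0) (i j : Fin 3) (k : ℕ)
    (h : w.1 = v.1 + k • (step i - step j)) : (graph n).Reachable v w := by
  induction k generalizing w with
  | zero =>
    have : v = w := Subtype.ext (by simpa using h.symm)
    rw [this]
  | succ k ih =>
    have hc : colour (v.1 + k • (step i - step j)) = 0 := by
      rw [map_add, hv, map_nsmul, map_sub, colour_step, colour_step, sub_self, smul_zero, zero_add]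
    have h1 := ih (w := ⟨_, by rw [hc]; decide⟩) rfl
    exact h1.trans (reachable_add_step_sub_step hc i j (by rw [h, succ_nsmul, add_assoc]))

lemma val_add_val_mod_three [NeZero n] {x : Lattice n} (hx : colour x = 0) :
    3 ∣ x.1.val + x.2.val := by
  rw [← ZMod.natCast_eq_zero_iff, Nat.cast_add]
  simpa [colour, ZMod.natCast_val] using hx

lemma connected [NeZero n] : (graph n).Connected := by
  have key (v : Vertex n) (hv : colour v.1 = 0) : (graph n).Reachable origin v := by
    obtain ⟨k, hk⟩ := val_add_val_mod_three hv
    have h0 : colour ((origin : Vertex n).1 + k • (step 0 - step 2)) = 0 := by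
      rw [map_add, map_nsmul, map_sub, colour_step, colour_step, sub_self, smul_zero, add_zero]
      exact map_zero _
    have h1 : (graph n).Reachable origin ⟨_, by rw [h0]; decide⟩ :=
      reachable_add_nsmul (map_zero colour) 0 2 k rfl
    refine h1.trans (reachable_add_nsmul h0 0 1 (v.1.1 - 2 * (k : ZMod (3 * n))).val ?_)
    have hk' : v.1.1 + v.1.2 = 3 * (k : ZMod (3 * n)) := by
      have := congrArg (Nat.cast : ℕ → ZMod (3 * n)) hk
      simpa using this
    ext
    · simp [origin, step]
      ring
    · simp [origin, step]
      linear_combination hk'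
  refine (SimpleGraph.connected_iff_exists_forall_reachable _).2 ⟨origin, fun v => ?_⟩
  rcases colour_eq v with hv | hv
  · exact key v hv
  · have hc : colour (v.1 - step 0) = 0 := by simp [hv]
    let w : Vertex n := ⟨v.1 - step 0, by rw [hc]; decide⟩
    have : (graph n).Adj v w := (adj_iff_of_colour_one hv).2 ⟨0, rfl⟩
    exact (key w hc).trans this.symm.reachable

end Connected

section Automorphisms

/-- The permutation `g` of the vertices is induced by `x ↦ f x + t`. -/
def IsInducedBy (g : Equiv.Perm (Vertex n)) (f : Lattice n ≃+ Lattice n) (t : Lattice n) : Prop :=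
  ∀ v, (g v).1 = f v.1 + t

lemma IsInducedBy.one : IsInducedBy (1 : Equiv.Perm (Vertex n)) (AddEquiv.refl _) 0 :=
  fun v => by simp

lemma IsInducedBy.mul {g g' : Equiv.Perm (Vertex n)} {f f' : Lattice n ≃+ Lattice n}
    {t t' : Lattice n} (h : IsInducedBy g f t) (h' : IsInducedBy g' f' t') :
    IsInducedBy (g * g') (f'.trans f) (f t' + t) := fun v => by
  rw [Equiv.Perm.mul_apply, h, h', map_add, AddEquiv.trans_apply, add_assoc]

lemma IsInducedBy.inv {g : Equiv.Perm (Vertex n)} {f : Lattice n ≃+ Lattice n}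
    {t : Lattice n} (h : IsInducedBy g f t) :
    IsInducedBy g⁻¹ f.symm (-f.symm t) := fun v => by
  have := h (g⁻¹ v)
  rw [show g (g⁻¹ v) = v from g.apply_symm_apply v] at this
  rw [this]
  simp

/-- Rotation through `2π/3` about the origin. -/
def rotation : Lattice n ≃+ Lattice n where
  toFun x := (-x.2, x.1 - x.2)
  invFun x := (x.2 - x.1, -x.1)
  left_inv x := by ext <;> simp
  right_inv x := by ext <;> simp
  map_add' x y := by ext <;> simp <;> ring

/-- Reflection in the line spanned by `step 0`. -/
def reflection : Lattice n ≃+ Lattice n where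
  toFun x := (x.1 - x.2, -x.2)
  invFun x := (x.1 - x.2, -x.2)
  left_inv x := by ext <;> simp
  right_inv x := by ext <;> simp
  map_add' x y := by ext <;> simp <;> ring

/-- The group of all automorphisms of the honeycomb graph induced by affine maps. -/
def affineGroup (n : ℕ) : Subgroup (Equiv.Perm (Vertex n)) where
  carrier := {g | g ∈ (graph n).autSubgroup ∧ ∃ f t, IsInducedBy g f t}
  one_mem' := ⟨one_mem _, _, _, .one⟩
  mul_mem' := by
    rintro _ _ ⟨ha, _, _, h⟩ ⟨hb, _, _, h'⟩
    exact ⟨mul_mem ha hb, _, _, h.mul h'⟩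
  inv_mem' := by
    rintro _ ⟨ha, _, _, h⟩
    exact ⟨inv_mem ha, _, _, h.inv⟩

/-- The group of automorphisms of the honeycomb graph induced by affine maps whose linear part
commutes with the rotation. -/
def rotaryGroup (n : ℕ) : Subgroup (Equiv.Perm (Vertex n)) where
  carrier := {g | g ∈ (graph n).autSubgroup ∧
    ∃ f t, IsInducedBy g f t ∧ ∀ x, f (rotation x) = rotation (f x)}
  one_mem' := ⟨one_mem _, _, _, .one, fun _ => rfl⟩
  mul_mem' := by
    rintro _ _ ⟨ha, _, _, h, hr⟩ ⟨hb, _, _, h', hr'⟩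
    exact ⟨mul_mem ha hb, _, _, h.mul h', fun x => by simp [hr, hr']⟩
  inv_mem' := by
    rintro _ ⟨ha, f, _, h, hr⟩
    exact ⟨inv_mem ha, _, _, h.inv, fun x => by rw [f.symm_apply_eq, hr, f.apply_symm_apply]⟩

lemma rotaryGroup_le : rotaryGroup n ≤ affineGroup n :=
  fun _ ⟨ha, f, t, h, _⟩ => ⟨ha, f, t, h⟩

lemma affineGroup_le : affineGroup n ≤ (graph n).autSubgroup := fun _ h => h.1

lemma rotation_step (i : Fin 3) : rotation (step i : Lattice n) = step (i + 1) := by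
  fin_cases i <;> simp [rotation, step]

lemma reflection_step (i : Fin 3) : reflection (step i : Lattice n) = step (-i) := by
  fin_cases i
  · simp [reflection, step]
  · simp [reflection, step, show (-1 : Fin 3) = 2 from rfl]
  · simp [reflection, step, show (-2 : Fin 3) = 1 from rfl]

/-- An additive map fixing two distinct unit steps is the identity. -/
lemma eq_refl_of_apply_step [NeZero n] {f : Lattice n ≃+ Lattice n} {i j : Fin 3} (hij : i ≠ j)
    (hi : f (step i) = step i) (hj : f (step j) = step j) : f = AddEquiv.refl _ := by
  have h := congrArg f (sum_step (n := n))
  rw [map_add, map_add, map_zero, ← sum_step (n := n)] at h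
  have h01 : f (step 0) = step 0 ∧ f (step 1) = step 1 := by
    fin_cases i <;> fin_cases j <;> simp_all
  ext1 x
  have hx : x = x.1.val • step 0 + x.2.val • step 1 := by
    ext <;> simp [step]
  rw [AddEquiv.refl_apply, hx, map_add, map_nsmul, map_nsmul, h01.1, h01.2]

/-- An additive map preserving colour up to sign, and the set of minimal vectors, induces an
automorphism of the honeycomb graph. -/
lemma exists_perm (f : Lattice n ≃+ Lattice n) (t : Lattice n)
    (hc : ∀ x, colour (f x + t) = 2 ↔ colour x = 2)
    (hf : ∀ x, IsUnitStep (f x) ↔ IsUnitStep x) :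
    ∃ g ∈ (graph n).autSubgroup, IsInducedBy g f t := by
  refine ⟨(f.toEquiv.trans (Equiv.addRight t)).subtypeEquiv fun x => (not_congr (hc x)).symm,
    fun x y => ?_, fun v => rfl⟩
  simp only [adj_iff, ← hf (x.1 - y.1)]
  simp

lemma isUnitStep_of_perm {f : Lattice n ≃+ Lattice n} (σ : Equiv.Perm (Fin 3))
    (h : ∀ i, f (step i) = step (σ i)) (x : Lattice n) : IsUnitStep (f x) ↔ IsUnitStep x := by
  constructor
  · rintro (⟨i, hi⟩ | ⟨i, hi⟩)
    · exact Or.inl ⟨σ.symm i, f.injective (by rw [h, hi, σ.apply_symm_apply])⟩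
    · exact Or.inr ⟨σ.symm i, f.injective (by rw [map_neg, h, hi, σ.apply_symm_apply])⟩
  · rintro (⟨i, rfl⟩ | ⟨i, rfl⟩)
    · exact Or.inl ⟨σ i, h i⟩
    · exact Or.inr ⟨σ i, by rw [map_neg, h]⟩

lemma colour_rotation (x : Lattice n) : colour (rotation x) = colour x := by
  simp only [colour, rotation, AddMonoidHom.coprod_apply]
  simp
  generalize (x.1.cast : ZMod 3) = a
  generalize (x.2.cast : ZMod 3) = b
  revert a b
  decide

lemma colour_reflection (x : Lattice n) : colour (reflection x) = colour x := by
  simp only [colour, reflection, AddMonoidHom.coprod_apply]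
  simp
  generalize (x.1.cast : ZMod 3) = a
  generalize (x.2.cast : ZMod 3) = b
  revert a b
  decide

lemma exists_translation (t : Lattice n) (ht : colour t = 0) :
    ∃ g ∈ rotaryGroup n, ∀ v, (g v).1 = v.1 + t := by
  obtain ⟨g, hg, h⟩ := exists_perm (AddEquiv.refl _) t (by simp [ht]) (by simp)
  exact ⟨g, ⟨hg, _, _, h, fun _ => rfl⟩, h⟩

lemma exists_rotation :
    ∃ g ∈ rotaryGroup n, ∀ v, (g v).1 = rotation v.1 := by
  obtain ⟨g, hg, h⟩ := exists_perm rotation (0 : Lattice n) (by simp [colour_rotation])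
    (isUnitStep_of_perm (Equiv.addRight 1) rotation_step)
  exact ⟨g, ⟨hg, _, _, h, fun _ => rfl⟩, fun v => by simpa using h v⟩

lemma exists_reflection :
    ∃ g ∈ affineGroup n, ∀ v, (g v).1 = reflection v.1 := by
  obtain ⟨g, hg, h⟩ := exists_perm reflection (0 : Lattice n) (by simp [colour_reflection])
    (isUnitStep_of_perm (Equiv.neg _) reflection_step)
  exact ⟨g, ⟨hg, _, _, h⟩, fun v => by simpa using h v⟩

lemma exists_inversion :
    ∃ g ∈ rotaryGroup n, ∀ v, (g v).1 = step 0 - v.1 := by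
  have hc (x : Lattice n) : colour (AddEquiv.neg _ x + step 0) = 2 ↔ colour x = 2 := by
    simp only [AddEquiv.neg_apply, map_add, map_neg, colour_step]
    generalize colour x = c
    revert c
    decide
  obtain ⟨g, hg, h⟩ := exists_perm (AddEquiv.neg _) (step 0 : Lattice n) hc
    fun x => isUnitStep_neg
  exact ⟨g, ⟨hg, _, _, h, fun x => (map_neg rotation x).symm⟩, fun v => by rw [h v]; simp; abel⟩

/-- The neighbour of the origin in direction `step i`. -/
def originNeighbor (i : Fin 3) : Vertex n := ⟨step i, by rw [colour_step]; decide⟩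

lemma exists_map_arc_to_origin {v u : Vertex n} (h : (graph n).Adj v u) :
    ∃ g ∈ rotaryGroup n, g v = origin ∧ g u = originNeighbor 0 := by
  have key {v u : Vertex n} (h : (graph n).Adj v u) (hv : colour v.1 = 0) :
      ∃ g ∈ rotaryGroup n, g v = origin ∧ g u = originNeighbor 0 := by
    obtain ⟨i, hi⟩ := (adj_iff_of_colour_zero hv).1 h
    obtain ⟨τ, hτ, hτ'⟩ := exists_translation (-v.1) (by simp [hv])
    obtain ⟨ρ, hρ, hρ'⟩ := exists_rotation (n := n)
    have hpow (k : ℕ) : (ρ ^ k) origin = origin ∧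
        (ρ ^ k) (originNeighbor i) = originNeighbor (i + k • 1) := by
      induction k with
      | zero => simp
      | succ k ih =>
        rw [pow_succ', Equiv.Perm.mul_apply, Equiv.Perm.mul_apply, ih.1, ih.2]
        refine ⟨Subtype.ext ?_, Subtype.ext ?_⟩
        · rw [hρ']
          exact map_zero _
        · rw [hρ', originNeighbor, rotation_step, originNeighbor, succ_nsmul, add_assoc]
    have h1 : τ v = origin := Subtype.ext (by rw [hτ']; simp [origin])
    have h2 : τ u = originNeighbor i := Subtype.ext (by rw [hτ', hi]; simp [originNeighbor])
    refine ⟨ρ ^ (-i).val * τ, mul_mem (pow_mem hρ _) hτ, ?_, ?_⟩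
    · rw [Equiv.Perm.mul_apply, h1, (hpow _).1]
    · have hi0 : ∀ i : Fin 3, i + (-i).val • 1 = 0 := by decide
      rw [Equiv.Perm.mul_apply, h2, (hpow _).2, hi0]
  rcases colour_eq v with hv | hv
  · exact key h hv
  · obtain ⟨ι, hι, hι'⟩ := exists_inversion (n := n)
    obtain ⟨g, hg, h1, h2⟩ := key (v := ι v) (u := ι u) ((hι.1 v u).2 h) (by rw [hι']; simp [hv])
    exact ⟨g * ι, mul_mem hg hι, h1, h2⟩

lemma exists_map_two_arc_to_origin {u v w : Vertex n} (huv : (graph n).Adj u v)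
    (hvw : (graph n).Adj v w) (huw : u ≠ w) :
    ∃ g ∈ affineGroup n, g u = originNeighbor 0 ∧ g v = origin ∧ g w = originNeighbor 1 := by
  obtain ⟨g, hg, hv, hu⟩ := exists_map_arc_to_origin huv.symm
  have hgw : (graph n).Adj (g v) (g w) := (hg.1 v w).2 hvw
  rw [hv] at hgw
  obtain ⟨i, hi⟩ := (adj_iff_of_colour_zero (map_zero colour)).1 hgw
  have hw : g w = originNeighbor i := Subtype.ext (by rw [hi]; simp [origin, originNeighbor])
  have hi0 : i ≠ 0 := fun h => huw (g.injective (by rw [hu, hw, h]))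
  obtain rfl | rfl : i = 1 ∨ i = 2 := by clear hw hi; revert i; decide
  · exact ⟨g, rotaryGroup_le hg, hu, hv, hw⟩
  · obtain ⟨r, hr, hr'⟩ := exists_reflection (n := n)
    refine ⟨r * g, mul_mem hr (rotaryGroup_le hg), ?_, ?_, ?_⟩
    · rw [Equiv.Perm.mul_apply, hu]
      exact Subtype.ext (by rw [hr', originNeighbor, reflection_step, neg_zero])
    · rw [Equiv.Perm.mul_apply, hv]
      exact Subtype.ext (by rw [hr']; exact map_zero _)
    · rw [Equiv.Perm.mul_apply, hw]
      exact Subtype.ext (by rw [hr', originNeighbor, reflection_step]; rfl)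

lemma IsInducedBy.map_sub {g : Equiv.Perm (Vertex n)} {f : Lattice n ≃+ Lattice n}
    {t : Lattice n} (h : IsInducedBy g f t) {u v : Vertex n} (hu : g u = u) (hv : g v = v) :
    f (u.1 - v.1) = u.1 - v.1 := by
  have h1 := h u
  have h2 := h v
  rw [hu] at h1
  rw [hv] at h2
  rw [_root_.map_sub, ← add_sub_add_right_eq_sub _ _ t, ← h1, ← h2]

lemma IsInducedBy.eq_one {g : Equiv.Perm (Vertex n)} {t : Lattice n}
    (h : IsInducedBy g (AddEquiv.refl _) t) {v : Vertex n} (hv : g v = v) : g = 1 := by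
  have ht := h v
  rw [hv, AddEquiv.refl_apply, left_eq_add] at ht
  refine Equiv.ext fun w => Subtype.ext ?_
  rw [h w, ht]
  simp

/-- If both ends of an arc are fixed, then the linear part fixes the direction of the arc. -/
lemma IsInducedBy.apply_step {g : Equiv.Perm (Vertex n)} {f : Lattice n ≃+ Lattice n}
    {t : Lattice n} (h : IsInducedBy g f t) {u v : Vertex n} (hu : g u = u) (hv : g v = v)
    {i : Fin 3} (huv : u.1 - v.1 = step i ∨ u.1 - v.1 = -step i) : f (step i) = step i := by
  have := h.map_sub hu hv
  rcases huv with huv | huv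
  · rwa [huv] at this
  · rwa [huv, map_neg, neg_inj] at this

lemma eq_one_of_mem_affineGroup [NeZero n] {g : Equiv.Perm (Vertex n)} (hg : g ∈ affineGroup n)
    {u v w : Vertex n} (huv : (graph n).Adj u v) (hvw : (graph n).Adj v w) (huw : u ≠ w)
    (hu : g u = u) (hv : g v = v) (hw : g w = w) : g = 1 := by
  obtain ⟨-, f, t, h⟩ := hg
  have key : ∃ i j, i ≠ j ∧ (u.1 - v.1 = step i ∨ u.1 - v.1 = -step i) ∧
      (w.1 - v.1 = step j ∨ w.1 - v.1 = -step j) := by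
    rcases colour_eq v with hc | hc
    · obtain ⟨i, hi⟩ := (adj_iff_of_colour_zero hc).1 huv.symm
      obtain ⟨j, hj⟩ := (adj_iff_of_colour_zero hc).1 hvw
      refine ⟨i, j, ?_, by simp [hi], by simp [hj]⟩
      rintro rfl
      exact huw (Subtype.ext (hi.trans hj.symm))
    · obtain ⟨i, hi⟩ := (adj_iff_of_colour_one hc).1 huv.symm
      obtain ⟨j, hj⟩ := (adj_iff_of_colour_one hc).1 hvw
      refine ⟨i, j, ?_, by simp [hi], by simp [hj]⟩
      rintro rfl
      exact huw (Subtype.ext (hi.trans hj.symm))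
  obtain ⟨i, j, hij, hi, hj⟩ := key
  obtain rfl := eq_refl_of_apply_step hij (h.apply_step hu hv hi) (h.apply_step hw hv hj)
  exact h.eq_one hv

lemma eq_one_of_mem_rotaryGroup [NeZero n] {g : Equiv.Perm (Vertex n)} (hg : g ∈ rotaryGroup n)
    {u v : Vertex n} (huv : (graph n).Adj u v) (hu : g u = u) (hv : g v = v) : g = 1 := by
  obtain ⟨-, f, t, h, hr⟩ := hg
  obtain ⟨i, hi⟩ : ∃ i, u.1 - v.1 = step i ∨ u.1 - v.1 = -step i := by
    rcases huv with ⟨i, hi⟩ | ⟨i, hi⟩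
    exacts [⟨i, Or.inl hi⟩, ⟨i, Or.inr hi⟩]
  have h1 := h.apply_step hu hv hi
  have h2 : f (step (i + 1)) = step (i + 1) := by rw [← rotation_step, hr, h1]
  obtain rfl := eq_refl_of_apply_step (by simp) h1 h2
  exact h.eq_one hv

lemma isArcRegular [NeZero n] : IsArcRegular (graph n) (rotaryGroup n) := by
  intro u v u' v' h h'
  obtain ⟨a, ha, hau, hav⟩ := exists_map_arc_to_origin h
  obtain ⟨b, hb, hbu, hbv⟩ := exists_map_arc_to_origin h'
  refine ⟨b⁻¹ * a, ⟨mul_mem (inv_mem hb) ha, ?_, ?_⟩, ?_⟩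
  · rw [Equiv.Perm.mul_apply, Equiv.Perm.inv_eq_iff_eq, hau, hbu]
  · rw [Equiv.Perm.mul_apply, Equiv.Perm.inv_eq_iff_eq, hav, hbv]
  · rintro g ⟨hg, hgu, hgv⟩
    have : a⁻¹ * (b * g) = 1 :=
      eq_one_of_mem_rotaryGroup (mul_mem (inv_mem ha) (mul_mem hb hg)) h
        (by rw [Equiv.Perm.mul_apply, Equiv.Perm.mul_apply, Equiv.Perm.inv_eq_iff_eq, hgu, hau, hbu])
        (by rw [Equiv.Perm.mul_apply, Equiv.Perm.mul_apply, Equiv.Perm.inv_eq_iff_eq, hgv, hav, hbv])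
    rw [eq_inv_mul_iff_mul_eq]
    exact (inv_mul_eq_one.1 this).symm

lemma is2ArcRegular [NeZero n] : Is2ArcRegular (graph n) (affineGroup n) := by
  intro u v w u' v' w' huv hvw huw huv' hvw' huw'
  obtain ⟨a, ha, hau, hav, haw⟩ := exists_map_two_arc_to_origin huv hvw huw
  obtain ⟨b, hb, hbu, hbv, hbw⟩ := exists_map_two_arc_to_origin huv' hvw' huw'
  refine ⟨b⁻¹ * a, ⟨mul_mem (inv_mem hb) ha, ?_, ?_, ?_⟩, ?_⟩
  · rw [Equiv.Perm.mul_apply, Equiv.Perm.inv_eq_iff_eq, hau, hbu]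
  · rw [Equiv.Perm.mul_apply, Equiv.Perm.inv_eq_iff_eq, hav, hbv]
  · rw [Equiv.Perm.mul_apply, Equiv.Perm.inv_eq_iff_eq, haw, hbw]
  · rintro g ⟨hg, hgu, hgv, hgw⟩
    have : a⁻¹ * (b * g) = 1 :=
      eq_one_of_mem_affineGroup (mul_mem (inv_mem ha) (mul_mem hb hg)) huv hvw huw
        (by rw [Equiv.Perm.mul_apply, Equiv.Perm.mul_apply, Equiv.Perm.inv_eq_iff_eq, hgu, hau, hbu])
        (by rw [Equiv.Perm.mul_apply, Equiv.Perm.mul_apply, Equiv.Perm.inv_eq_iff_eq, hgv, hav, hbv])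
        (by rw [Equiv.Perm.mul_apply, Equiv.Perm.mul_apply, Equiv.Perm.inv_eq_iff_eq, hgw, haw, hbw])
    rw [eq_inv_mul_iff_mul_eq]
    exact (inv_mul_eq_one.1 this).symm

end Automorphisms

section Nullity

open Polynomial

variable (n) in
/-- The polynomial `(X² + X + 1)ⁿ` over `𝔽₂`. -/
noncomputable def modulus : (ZMod 2)[X] := (X ^ 2 + X + 1) ^ n

lemma monic_modulus : (modulus n).Monic := by
  have : (X ^ 2 + X + 1 : (ZMod 2)[X]).Monic := by monicity!
  exact this.pow n

lemma natDegree_modulus : (modulus n).natDegree = 2 * n := by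
  have : (X ^ 2 + X + 1 : (ZMod 2)[X]).natDegree = 2 := by compute_degree!
  rw [modulus, natDegree_pow, this, mul_comm]

variable (n) in
/-- The quotient of `𝔽₂[X]` by `(X² + X + 1)ⁿ`. -/
abbrev QuotientRing : Type := AdjoinRoot (modulus n)

variable (n) in
/-- The class of `X`. -/
noncomputable abbrev root : QuotientRing n := AdjoinRoot.root (modulus n)

lemma root_pow_eq_one (m : ℕ) : root (2 ^ m) ^ (3 * 2 ^ m) = 1 := by
  have h : (X : (ZMod 2)[X]) ^ (3 * 2 ^ m) - 1 = modulus (2 ^ m) * (X - 1) ^ 2 ^ m := by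
    rw [modulus, ← mul_pow, pow_mul, ← one_pow (2 ^ m), ← sub_pow_char_pow, one_pow]
    congr 1
    ring
  have := congrArg (AdjoinRoot.mk (modulus (2 ^ m))) h
  rw [map_mul, AdjoinRoot.mk_self, zero_mul, map_sub, map_pow, map_one, AdjoinRoot.mk_X] at this
  exact sub_eq_zero.1 this

lemma root_mul_pow_eq_one (m : ℕ) : (root (2 ^ m) * (root (2 ^ m) + 1)) ^ (2 ^ m) = 1 := by
  have h : ((X : (ZMod 2)[X]) * (X + 1)) ^ (2 ^ m) = modulus (2 ^ m) + 1 := by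
    rw [modulus, ← one_pow (2 ^ m), ← add_pow_char_pow, one_pow]
    congr 1
    have : (2 : (ZMod 2)[X]) = 0 := CharTwo.two_eq_zero
    linear_combination -this
  have := congrArg (AdjoinRoot.mk (modulus (2 ^ m))) h
  rwa [map_add, AdjoinRoot.mk_self, zero_add, map_pow, map_mul, map_add, map_one,
    AdjoinRoot.mk_X] at this

lemma pow_val_natCast {M : Type*} [Monoid M] {N : ℕ} {g : M} (hg : g ^ N = 1) (k : ℕ) :
    g ^ (k : ZMod N).val = g ^ k := by
  rw [ZMod.val_natCast, ← pow_eq_pow_mod k hg]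

lemma pow_val_natCast_div {M : Type*} [Monoid M] {g : M} (hg : g ^ n = 1) (k : ℕ) :
    g ^ (((3 * k : ℕ) : ZMod (3 * n)).val / 3) = g ^ k := by
  rw [ZMod.val_natCast, Nat.mul_mod_mul_left, Nat.mul_div_cancel_left _ three_pos,
    ← pow_eq_pow_mod k hg]

/-- On points of colour `0` this is the character sending `step 0 - step 1` to the class of `X` and
`step 0 - step 2` to the class of `X + 1`. -/
noncomputable def character (x : Lattice n) : QuotientRing n :=
  root n ^ (-x.2).val * (root n * (root n + 1)) ^ ((x.1 + x.2).val / 3)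

lemma character_add_step_zero_sub_step_one (m : ℕ) (x : Lattice (2 ^ m)) :
    character (x + (step 0 - step 1)) = root (2 ^ m) * character x := by
  have h1 : -(x + (step 0 - step 1)).2 = (((-x.2).val + 1 : ℕ) : ZMod (3 * 2 ^ m)) := by
    simp [step]
    ring
  have h2 : (x + (step 0 - step 1)).1 + (x + (step 0 - step 1)).2 = x.1 + x.2 := by
    simp [step]
    ring
  rw [character, character, h1, h2, pow_val_natCast (root_pow_eq_one m), pow_succ']
  ring

lemma character_add_three (m : ℕ) {x : Lattice (2 ^ m)} (hx : colour x = 0) :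
    character (x + (3, 0)) = root (2 ^ m) * (root (2 ^ m) + 1) * character x := by
  obtain ⟨k, hk⟩ : 3 ∣ (x.1 + x.2).val := by
    rw [← ZMod.natCast_eq_zero_iff, ZMod.natCast_val, ZMod.cast_add (dvd_mul_right 3 _)]
    exact hx
  have hk' : x.1 + x.2 = ((3 * k : ℕ) : ZMod (3 * 2 ^ m)) := by
    rw [← hk, ZMod.natCast_zmod_val]
  have h2 : (x + (3, 0)).1 + (x + (3, 0)).2 = ((3 * (k + 1) : ℕ) : ZMod (3 * 2 ^ m)) := by
    have : (x + (3, 0)).1 + (x + (3, 0)).2 = x.1 + x.2 + 3 := by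
      simp
      ring
    rw [this, hk']
    push_cast
    ring
  have h1 : (x + (3, 0)).2 = x.2 := by simp
  rw [character, character, h2, h1, hk', pow_val_natCast_div (root_mul_pow_eq_one m),
    pow_val_natCast_div (root_mul_pow_eq_one m), pow_succ]
  ring

lemma isUnit_root (m : ℕ) : IsUnit (root (2 ^ m)) :=
  IsUnit.of_pow_eq_one (root_pow_eq_one m) (by positivity)

lemma character_add_step_zero_sub_step_two (m : ℕ) {x : Lattice (2 ^ m)} (hx : colour x = 0) :
    character (x + (step 0 - step 2)) = (root (2 ^ m) + 1) * character x := by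
  refine (isUnit_root m).mul_left_cancel ?_
  rw [← character_add_step_zero_sub_step_one, ← mul_assoc, ← character_add_three m hx]
  congr 1
  ext <;> simp [step]; ring

lemma sum_character (m : ℕ) {x : Lattice (2 ^ m)} (hx : colour x = 0) :
    ∑ i, character (x + (step 0 - step i)) = 0 := by
  have h2 : (2 : QuotientRing (2 ^ m)) = 0 := by
    have := congrArg (algebraMap (ZMod 2) (QuotientRing (2 ^ m))) (show (2 : ZMod 2) = 0 from rfl)
    rwa [map_ofNat, map_zero] at this
  rw [Fin.sum_univ_three, sub_self, add_zero, character_add_step_zero_sub_step_one,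
    character_add_step_zero_sub_step_two m hx]
  linear_combination (1 + root (2 ^ m)) * character x * h2

lemma character_nsmul (m k : ℕ) :
    character (k • (step 0 - step 1) : Lattice (2 ^ m)) = root (2 ^ m) ^ k := by
  induction k with
  | zero => simp [character]
  | succ k ih => rw [succ_nsmul, character_add_step_zero_sub_step_one, ih, pow_succ']

lemma eq_zero_of_apply_root_pow {φ : Module.Dual (ZMod 2) (QuotientRing n)}
    (h : ∀ k : ℕ, φ (root n ^ k) = 0) : φ = 0 := by
  have : φ ∘ₗ (AdjoinRoot.mkₐ (modulus n)).toLinearMap = 0 := by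
    refine Polynomial.lhom_ext' fun k => LinearMap.ext_ring ?_
    simpa [← X_pow_eq_monomial] using h k
  refine LinearMap.ext fun a => ?_
  obtain ⟨p, rfl⟩ := AdjoinRoot.mk_surjective a
  exact LinearMap.congr_fun this p

open scoped Classical in
/-- A pair of functionals gives a function on the vertices through the character. -/
noncomputable def ofDual (n : ℕ) :
    Module.Dual (ZMod 2) (QuotientRing n) × Module.Dual (ZMod 2) (QuotientRing n) →ₗ[ZMod 2]
      (Vertex n → ZMod 2) where
  toFun φ v := if colour v.1 = 0 then φ.1 (character v.1) else φ.2 (character (step 0 - v.1))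
  map_add' φ ψ := by ext v; split_ifs <;> simp_all
  map_smul' c φ := by ext v; split_ifs <;> simp_all

lemma ofDual_mem_nullspace (m : ℕ)
    (φ : Module.Dual (ZMod 2) (QuotientRing (2 ^ m)) ×
      Module.Dual (ZMod 2) (QuotientRing (2 ^ m))) :
    ofDual (2 ^ m) φ ∈ nullspace (ZMod 2) (graph (2 ^ m)) := by
  classical
  intro v
  obtain ⟨e, he⟩ := exists_neighborEquiv v
  rw [← Equiv.sum_comp e]
  rcases he with ⟨hv, he⟩ | ⟨hv, he⟩
  · have hc (i : Fin 3) : colour (e i).1.1 ≠ 0 := by rw [he]; simp [hv]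
    have hx (i : Fin 3) : step 0 - (e i).1.1 = -v.1 + (step 0 - step i) := by rw [he]; abel
    simp only [ofDual, LinearMap.coe_mk, AddHom.coe_mk, hc, if_false, hx, ← map_sum]
    rw [sum_character m (by simp [hv]), map_zero]
  · have hc (i : Fin 3) : colour (e i).1.1 = 0 := by rw [he]; simp [hv]
    have hx (i : Fin 3) : (e i).1.1 = v.1 - step 0 + (step 0 - step i) := by rw [he]; abel
    simp only [ofDual, LinearMap.coe_mk, AddHom.coe_mk, hc, if_true, ← map_sum]
    simp only [hx]
    rw [sum_character m (by simp [hv]), map_zero]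

lemma ofDual_injective (m : ℕ) : Function.Injective (ofDual (2 ^ m)) := by
  rw [injective_iff_map_eq_zero]
  rintro ⟨φ, ψ⟩ h
  have hc (k : ℕ) : colour (k • (step 0 - step 1) : Lattice (2 ^ m)) = 0 := by
    rw [map_nsmul, map_sub, colour_step, colour_step, sub_self, smul_zero]
  refine Prod.ext (eq_zero_of_apply_root_pow fun k => ?_) (eq_zero_of_apply_root_pow fun k => ?_)
  · have := congrFun h ⟨k • (step 0 - step 1), by rw [hc]; decide⟩
    simpa only [ofDual, LinearMap.coe_mk, AddHom.coe_mk, hc, if_true, character_nsmul,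
      Pi.zero_apply] using this
  · have hc' : colour (step 0 - k • (step 0 - step 1) : Lattice (2 ^ m)) = 1 := by
      rw [map_sub, hc, colour_step, sub_zero]
    have := congrFun h ⟨step 0 - k • (step 0 - step 1), by rw [hc']; decide⟩
    simpa only [ofDual, LinearMap.coe_mk, AddHom.coe_mk, hc', one_ne_zero, if_false,
      sub_sub_cancel, character_nsmul, Pi.zero_apply] using this

lemma le_finrank_nullspace (m : ℕ) :
    4 * 2 ^ m ≤ Module.finrank (ZMod 2) (nullspace (ZMod 2) (graph (2 ^ m))) := by
  have hne : modulus (2 ^ m) ≠ 0 := monic_modulus.ne_zero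
  have := (AdjoinRoot.powerBasis hne).finite
  have hrank : Module.finrank (ZMod 2) (QuotientRing (2 ^ m)) = 2 * 2 ^ m := by
    rw [(AdjoinRoot.powerBasis hne).finrank, AdjoinRoot.powerBasis_dim, natDegree_modulus]
  have hle := LinearMap.finrank_le_finrank_of_injective
    (f := (ofDual (2 ^ m)).codRestrict _ (ofDual_mem_nullspace m))
    ((LinearMap.injective_codRestrict_iff _).2 (ofDual_injective m))
  rw [Module.finrank_prod, Subspace.dual_finrank_eq, hrank] at hle
  omega

end Nullity

end Honeycomb

/-- For every positive integer `m` there is a connected cubic graph of order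
`6·2^{2m}` with `F₂`-nullity at least `4·2^m`, admitting an arc-regular group `H` and a
2-arc-regular group `G` of automorphisms with `H ≤ G`. -/
theorem statement12 (m : ℕ) (hm : 0 < m) :
    ∃ (V : Type) (inst : Fintype V) (Γ : SimpleGraph V) (H G : Subgroup (Equiv.Perm V)),
      Nat.card V = 6 * 2 ^ (2 * m) ∧ Γ.Connected ∧
      (∀ v : V, Nat.card ↥(Γ.neighborSet v) = 3) ∧
      4 * 2 ^ m ≤ Module.finrank (ZMod 2) ↥(@nullspace V inst (ZMod 2) _ Γ) ∧
      H ≤ Γ.autSubgroup ∧ G ≤ Γ.autSubgroup ∧ H ≤ G ∧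
      IsArcRegular Γ H ∧ Is2ArcRegular Γ G := by
  refine ⟨Honeycomb.Vertex (2 ^ m), inferInstance, Honeycomb.graph _,
    Honeycomb.rotaryGroup _, Honeycomb.affineGroup _, ?_, Honeycomb.connected,
    Honeycomb.card_neighborSet, Honeycomb.le_finrank_nullspace m,
    Honeycomb.rotaryGroup_le.trans Honeycomb.affineGroup_le, Honeycomb.affineGroup_le,
    Honeycomb.rotaryGroup_le, Honeycomb.isArcRegular, Honeycomb.is2ArcRegular⟩
  rw [Honeycomb.card_vertex, ← pow_mul, mul_comm m 2]
end

section
/- Let L be a transitive permutation group of degree 6 that is imprimitive but does not admit a system of imprimitivity consisting of two blocks. Then L is f-graph-unrestrictive for the function f(n) = 4^{√(n/3) − 1}; in particular, L is Subexp-graph-unrestrictive. -/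
/-- `C` is a block for the permutation group `L`: every element of `L` maps `C` either to
itself or to a set disjoint from it. -/
def IsBlockOf {Ω : Type*} (L : Subgroup (Equiv.Perm Ω)) (C : Set Ω) : Prop :=
  ∀ g ∈ L, g '' C = C ∨ Disjoint (g '' C) C

/-- A function of the class `Subexp`: `log(f(n))/log(n)` is unbounded and `log(f(n))/n → 0`. -/
def InSubexpClass (f : ℕ → ℝ) : Prop :=
  (∀ C : ℝ, ∃ n : ℕ, C < Real.log (f n) / Real.log (n : ℝ)) ∧
  Filter.Tendsto (fun n : ℕ => Real.log (f n) / (n : ℝ)) Filter.atTop (nhds 0)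

/-- The set `S` of pairs `(m, π)` contains `E ⋊ C₃` as soon as it contains the 3-cycle and some pair
with non-constant first component; hence it is a union of fibres of `(∑ m, sign π)`. -/
theorem wreath_mem_iff (S : (Fin 3 → ZMod 2) → Equiv.Perm (Fin 3) → Prop)
    (hmul : ∀ m π m' π', S m π → S m' π' → S (m' + m ∘ π') (π * π'))
    (hrot : S 0 (finRotate 3))
    (hne : ∃ m π, S m π ∧ ∃ i j, m i ≠ m j)
    {m m' : Fin 3 → ZMod 2} {π π' : Equiv.Perm (Fin 3)} (h : S m π)
    (hsum : ∑ i, m i = ∑ i, m' i) (hsign : Equiv.Perm.sign π = Equiv.Perm.sign π') :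
    S m' π' := by
  have hrotpow : ∀ j : Fin 3, S 0 (finRotate 3 ^ (j : ℕ)) := by
    have h2 : S 0 (finRotate 3 ^ 2) := by
      have := hmul _ _ _ _ hrot hrot
      simpa [pow_two] using this
    have h3 : S 0 (finRotate 3 ^ 0) := by
      have := hmul _ _ _ _ hrot h2
      have h4 : finRotate 3 * finRotate 3 ^ 2 = finRotate 3 ^ 0 := by decide
      simpa [h4] using this
    intro j
    fin_cases j
    · exact h3
    · simpa using hrot
    · exact h2
  have hker : ∃ k : Fin 3 → ZMod 2, S k 1 ∧ ∃ i j, k i ≠ k j := by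
    obtain ⟨m, π, hS, hm⟩ := hne
    have key : ∀ (m : Fin 3 → ZMod 2) (π : Equiv.Perm (Fin 3)), (∃ i j, m i ≠ m j) →
        (∃ l : Fin 3, π * finRotate 3 ^ (l : ℕ) = 1) ∨
        ∃ j l : Fin 3, π * (finRotate 3 ^ (j : ℕ)) * π * finRotate 3 ^ (l : ℕ) = 1 ∧
          ∃ i i', (m + m ∘ ⇑(finRotate 3 ^ (j : ℕ)) ∘ π) i ≠
            (m + m ∘ ⇑(finRotate 3 ^ (j : ℕ)) ∘ π) i' := by
      decide +kernel
    have comp : ∀ (f : Fin 3 → ZMod 2) (σ : Equiv.Perm (Fin 3)), (∃ i j, f i ≠ f j) →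
        ∃ i j, (f ∘ σ) i ≠ (f ∘ σ) j := by
      rintro f σ ⟨i, j, hij⟩
      exact ⟨σ⁻¹ i, σ⁻¹ j, by simpa using hij⟩
    rcases key m π hm with ⟨l, hl⟩ | ⟨j, l, hl, hk⟩
    · have := hmul _ _ _ _ hS (hrotpow l)
      rw [hl, zero_add] at this
      exact ⟨_, this, comp _ _ hm⟩
    · have := hmul _ _ _ _ (hmul _ _ _ _ (hmul _ _ _ _ hS (hrotpow j)) hS) (hrotpow l)
      rw [hl, zero_add, zero_add] at this
      exact ⟨_, this, comp _ _ hk⟩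
  obtain ⟨k, hkS, hk⟩ := hker
  have hE : ∀ a : Fin 3 → ZMod 2, ∑ i, a i = 0 → S a 1 := by
    have key : ∀ k a : Fin 3 → ZMod 2, (∃ i j, k i ≠ k j) → ∑ i, a i = 0 →
        ∃ j j' : Fin 3, a = k ∘ ⇑(finRotate 3 ^ (j : ℕ)) + k ∘ ⇑(finRotate 3 ^ (j' : ℕ)) := by
      decide +kernel
    have hconj : ∀ j : Fin 3, S (k ∘ ⇑(finRotate 3 ^ (j : ℕ))) 1 := by
      intro j
      have hinv : ∀ j : Fin 3, ∃ l : Fin 3, finRotate 3 ^ (l : ℕ) * finRotate 3 ^ (j : ℕ) = 1 := by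
        decide
      obtain ⟨l, hl⟩ := hinv j
      have := hmul _ _ _ _ (hrotpow l) (hmul _ _ _ _ hkS (hrotpow j))
      rw [one_mul, hl] at this
      simpa using this
    intro a ha
    obtain ⟨j, j', rfl⟩ := key k a hk ha
    have := hmul _ _ _ _ (hconj j') (hconj j)
    simpa using this
  have hcoset : ∀ π π' : Equiv.Perm (Fin 3), Equiv.Perm.sign π = Equiv.Perm.sign π' →
      ∃ j : Fin 3, π * finRotate 3 ^ (j : ℕ) = π' := by
    decide +kernel
  obtain ⟨j, hj⟩ := hcoset π π' hsign
  have h1 := hmul _ _ _ _ h (hrotpow j)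
  rw [hj, zero_add] at h1
  have h2 : S (m' + m ∘ ⇑(finRotate 3 ^ (j : ℕ))) 1 := by
    apply hE
    have : ∑ i, m ((finRotate 3 ^ (j : ℕ)) i) = ∑ i, m i :=
      Equiv.sum_comp (finRotate 3 ^ (j : ℕ)) m
    simp only [Pi.add_apply, Function.comp_apply, Finset.sum_add_distrib, this, hsum]
    exact CharTwo.add_self_eq_zero _
  have h3 := hmul _ _ _ _ h1 h2
  have h4 : m' + m ∘ ⇑(finRotate 3 ^ (j : ℕ)) + m ∘ ⇑(finRotate 3 ^ (j : ℕ)) = m' := by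
    rw [add_assoc, CharTwo.add_self_eq_zero, add_zero]
  simpa [h4] using h3

open scoped Pointwise in
/-- A permutation group of degree 6 with a block of size 2, transitive, has a labelling
by `Fin 3 × ZMod 2` in which the fibres over `Fin 3` are blocks and some element is the
standard 3-cycle on `Fin 3`. -/
theorem exists_labelling {Ω : Type} [Fintype Ω] (L : Subgroup (Equiv.Perm Ω))
    (hdeg : Fintype.card Ω = 6) (hL : IsTransPerm L)
    (himpr : ∃ C : Set Ω, IsBlockOf L C ∧ 1 < C.ncard ∧ C.ncard < 6)
    (hno3 : ¬ ∃ C : Set Ω, IsBlockOf L C ∧ C.ncard = 3) :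
    ∃ F : Fin 3 × ZMod 2 ≃ Ω,
      (∃ ρ ∈ L, ∀ i s, ρ (F (i, s)) = F (finRotate 3 i, s)) ∧
      ∀ g ∈ L, ∀ i, (F.symm (g (F (i, 0)))).1 = (F.symm (g (F (i, 1)))).1 := by
  classical
  obtain ⟨C, hC, hC1, hC6⟩ := himpr
  have htrans : MulAction.IsPretransitive L Ω :=
    ⟨fun a b => by obtain ⟨g, hg, h⟩ := hL a b; exact ⟨⟨g, hg⟩, h⟩⟩
  have hblock : MulAction.IsBlock L C := by
    rw [MulAction.isBlock_iff_smul_eq_or_disjoint]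
    intro g
    exact hC g.1 g.2
  have hcard2 : C.ncard = 2 := by
    have h1 := hblock.ncard_dvd_card (Set.nonempty_of_ncard_ne_zero (by omega))
    rw [Nat.card_eq_fintype_card, hdeg] at h1
    have h3 : C.ncard ≠ 3 := fun h => hno3 ⟨C, hC, h⟩
    interval_cases h : C.ncard <;> omega
  have hne : Nonempty Ω := Fintype.card_pos_iff.mp (by omega)
  obtain ⟨ρ, hρL, hρ⟩ : ∃ ρ ∈ L, orderOf ρ = 3 := by
    have h6 : 3 ∣ Nat.card L := by
      obtain ⟨ω⟩ := hne
      have h1 := MulAction.index_stabilizer_of_transitive L ω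
      rw [Nat.card_eq_fintype_card, hdeg] at h1
      have h2 := (MulAction.stabilizer L ω).index_dvd_card
      rw [h1] at h2
      exact (by norm_num : 3 ∣ 6).trans h2
    have : Fact (Nat.Prime 3) := ⟨Nat.prime_three⟩
    obtain ⟨x, hx⟩ := exists_prime_orderOf_dvd_card' 3 h6
    exact ⟨x.1, x.2, by rw [Subgroup.orderOf_coe]; exact hx⟩
  have hρ3 : ρ ^ 3 = 1 := by rw [← hρ]; exact pow_orderOf_eq_one ρ
  obtain ⟨α, hα⟩ : ∃ α, ρ α ≠ α := by
    by_contra! h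
    have : ρ = 1 := Equiv.ext h
    rw [this, orderOf_one] at hρ
    omega
  obtain ⟨β, hαβ, hblk⟩ : ∃ β, α ≠ β ∧ ∀ g ∈ L,
      (g α ∈ ({α, β} : Set Ω) ∨ g β ∈ ({α, β} : Set Ω)) →
        (g α ∈ ({α, β} : Set Ω) ∧ g β ∈ ({α, β} : Set Ω)) := by
    obtain ⟨x, hx⟩ : C.Nonempty := Set.nonempty_of_ncard_ne_zero (by omega)
    obtain ⟨g, hg, hgx⟩ := hL x α
    have hb2 : MulAction.IsBlock L ((⟨g, hg⟩ : L) • C) := hblock.translate _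
    have hc2 : ((⟨g, hg⟩ : L) • C).ncard = 2 := by
      rw [Set.ncard_smul_set]; exact hcard2
    have hmem : α ∈ ((⟨g, hg⟩ : L) • C) := ⟨x, hx, hgx⟩
    generalize ((⟨g, hg⟩ : L) • C) = D at hb2 hc2 hmem
    obtain ⟨a, b, hab, rfl⟩ := Set.ncard_eq_two.mp hc2
    obtain ⟨β, hαβ, hD⟩ : ∃ β, α ≠ β ∧ ({a, b} : Set Ω) = {α, β} := by
      rcases hmem with rfl | rfl
      · exact ⟨b, hab, rfl⟩
      · exact ⟨a, hab.symm, Set.pair_comm _ _⟩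
    rw [hD] at hb2
    rw [MulAction.isBlock_iff_smul_eq_or_disjoint] at hb2
    refine ⟨β, hαβ, fun k hk h => ?_⟩
    have hα' : k α ∈ ((⟨k, hk⟩ : L) • ({α, β} : Set Ω)) := ⟨α, by simp, rfl⟩
    have hβ' : k β ∈ ((⟨k, hk⟩ : L) • ({α, β} : Set Ω)) := ⟨β, by simp, rfl⟩
    rcases hb2 ⟨k, hk⟩ with h1 | h1
    · rw [h1] at hα' hβ'
      exact ⟨hα', hβ'⟩
    · rcases h with h | h
      · exact (Set.disjoint_left.mp h1 hα' h).elim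
      · exact (Set.disjoint_left.mp h1 hβ' h).elim
  let c : ZMod 2 → Ω := fun s => if s = 0 then α else β
  have hc0 : c 0 = α := rfl
  have hc1 : c 1 = β := rfl
  have hz : ∀ s : ZMod 2, s = 0 ∨ s = 1 := by decide
  have hcmem : ∀ x, x ∈ ({α, β} : Set Ω) ↔ ∃ s, x = c s := by
    intro x
    constructor
    · rintro (rfl | rfl)
      · exact ⟨0, rfl⟩
      · exact ⟨1, rfl⟩
    · rintro ⟨s, rfl⟩
      rcases hz s with rfl | rfl
      · left; rfl
      · right; rfl
  have hblk' : ∀ g ∈ L, ∀ s s', g (c s) = c s' → ∀ r, ∃ r', g (c r) = c r' := by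
    intro g hg s s' h r
    have h0 := hblk g hg (by
      rcases hz s with rfl | rfl
      · left; rw [← hc0, h]; exact (hcmem _).mpr ⟨_, rfl⟩
      · right; rw [← hc1, h]; exact (hcmem _).mpr ⟨_, rfl⟩)
    rcases hz r with rfl | rfl
    · exact (hcmem _).mp h0.1
    · exact (hcmem _).mp h0.2
  have hcinj : Function.Injective c := by
    intro s s' h
    rcases hz s with rfl | rfl <;> rcases hz s' with rfl | rfl
    · rfl
    · exact (hαβ h).elim
    · exact (hαβ h.symm).elim
    · rfl
  have hρC : ∀ s s', ρ (c s) ≠ c s' := by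
    intro s s' h
    have h0 := hblk' ρ hρL s s' h
    obtain ⟨r, hr⟩ := h0 0
    obtain ⟨r', hr'⟩ := h0 1
    have h30 : ρ (ρ (ρ α)) = α := by
      have := congrArg (fun f : Equiv.Perm Ω => f α) hρ3
      simpa [pow_succ] using this
    rcases hz r with rfl | rfl
    · exact hα hr
    · rw [hc0, hc1] at hr
      rw [hc1] at hr'
      rcases hz r' with rfl | rfl
      · rw [hr, hr', hc0, hr] at h30
        exact hαβ h30.symm
      · rw [hr, hr', hc1, hr', hc1] at h30
        exact hαβ h30.symm
  have hρ2C : ∀ s s', (ρ ^ 2) (c s) ≠ c s' := by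
    intro s s' h
    have := congrArg (fun f : Equiv.Perm Ω => f (c s)) hρ3
    rw [pow_succ'] at this
    simp only [Equiv.Perm.mul_apply, Equiv.Perm.one_apply] at this
    rw [h] at this
    exact hρC _ _ this
  let F₀ : Fin 3 × ZMod 2 → Ω := fun x => (ρ ^ (x.1 : ℕ)) (c x.2)
  have hF₀ : Function.Injective F₀ := by
    rintro ⟨i, s⟩ ⟨j, s'⟩ h
    have hlt : ∀ i j : Fin 3, i < j → ∀ s s', (ρ ^ (i : ℕ)) (c s) ≠ (ρ ^ (j : ℕ)) (c s') := by
      intro i j hij s s' h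
      have h1 : (j : ℕ) = i + (j - i) := by have : (i : ℕ) < j := hij; omega
      rw [h1, pow_add, Equiv.Perm.mul_apply] at h
      have h2 := (ρ ^ (i : ℕ)).injective h
      have h3 : (j : ℕ) - i = 1 ∨ (j : ℕ) - i = 2 := by
        have : (i : ℕ) < j := hij
        have := j.2
        omega
      rcases h3 with h3 | h3
      · rw [h3, pow_one] at h2; exact hρC _ _ h2.symm
      · rw [h3] at h2; exact hρ2C _ _ h2.symm
    rcases lt_trichotomy i j with hij | rfl | hij
    · exact (hlt _ _ hij _ _ h).elim
    · exact Prod.ext rfl (hcinj ((ρ ^ (i : ℕ)).injective h))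
    · exact (hlt _ _ hij _ _ h.symm).elim
  have hbij : Function.Bijective F₀ := by
    rw [Fintype.bijective_iff_injective_and_card]
    exact ⟨hF₀, by simp [hdeg]⟩
  let F := Equiv.ofBijective F₀ hbij
  have hF : ∀ i s, F (i, s) = (ρ ^ (i : ℕ)) (c s) := fun _ _ => rfl
  refine ⟨F, ⟨ρ, hρL, ?_⟩, ?_⟩
  · intro i s
    rw [hF, hF]
    fin_cases i
    · rfl
    · rfl
    · change ρ ((ρ ^ 2) (c s)) = (ρ ^ 0) (c s)
      rw [← Equiv.Perm.mul_apply, ← pow_succ', hρ3, pow_zero]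
  · intro g hg i
    obtain ⟨⟨j, s⟩, hjs⟩ := F.surjective (g (F (i, 0)))
    have h1 : ((ρ ^ (j : ℕ))⁻¹ * g * ρ ^ (i : ℕ)) (c 0) = c s := by
      rw [hF, hF] at hjs
      simp only [Equiv.Perm.mul_apply]
      rw [← hjs, ← Equiv.Perm.mul_apply, inv_mul_cancel, Equiv.Perm.one_apply]
    obtain ⟨s', hs'⟩ := hblk' _ (L.mul_mem (L.mul_mem (L.inv_mem (L.pow_mem hρL _)) hg)
      (L.pow_mem hρL _)) _ _ h1 1
    have h2 : g (F (i, 1)) = F (j, s') := by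
      rw [hF, hF, ← hs']
      simp only [Equiv.Perm.mul_apply]
      rw [← Equiv.Perm.mul_apply (ρ ^ (j : ℕ)), mul_inv_cancel, Equiv.Perm.one_apply]
    rw [h2, ← hjs, Equiv.symm_apply_apply, Equiv.symm_apply_apply]

/-- A transitive group of degree 6 with blocks of size 2 but none of size 3 is, in a suitable
labelling, the preimage in `C₂ ≀ S₃` of a subgroup `Q` of `C₂ × {±1}` under
`(m, π) ↦ (∑ m, sign π)`. -/
theorem exists_wreath_description {Ω : Type} [Fintype Ω] (L : Subgroup (Equiv.Perm Ω))
    (hdeg : Fintype.card Ω = 6) (hL : IsTransPerm L)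
    (himpr : ∃ C : Set Ω, IsBlockOf L C ∧ 1 < C.ncard ∧ C.ncard < 6)
    (hno3 : ¬ ∃ C : Set Ω, IsBlockOf L C ∧ C.ncard = 3) :
    ∃ (F : Fin 3 × ZMod 2 ≃ Ω) (Q : ZMod 2 → ℤˣ → Prop), Q 0 1 ∧
      (∀ c s c' s', Q c s → Q c' s' → Q (c + c') (s * s')) ∧
      ∀ σ : Equiv.Perm Ω, σ ∈ L ↔ ∃ (m : Fin 3 → ZMod 2) (π : Equiv.Perm (Fin 3)),
        Q (∑ i, m i) (Equiv.Perm.sign π) ∧ ∀ i s, σ (F (i, s)) = F (π i, s + m i) := by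
  obtain ⟨F, ⟨ρ, hρ, hρF⟩, hF⟩ := exists_labelling L hdeg hL himpr hno3
  let S : (Fin 3 → ZMod 2) → Equiv.Perm (Fin 3) → Prop := fun m π =>
    ∃ σ ∈ L, ∀ i s, σ (F (i, s)) = F (π i, s + m i)
  have hmul : ∀ m π m' π', S m π → S m' π' → S (m' + m ∘ π') (π * π') := by
    rintro m π m' π' ⟨σ, hσ, h⟩ ⟨σ', hσ', h'⟩
    refine ⟨σ * σ', L.mul_mem hσ hσ', fun i s => ?_⟩
    rw [Equiv.Perm.mul_apply, h', h]
    simp [add_assoc]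
  have hrot : S 0 (finRotate 3) := ⟨ρ, hρ, fun i s => by simpa using hρF i s⟩
  have hform : ∀ σ ∈ L, ∃ (m : Fin 3 → ZMod 2) (π : Equiv.Perm (Fin 3)),
      ∀ i s, σ (F (i, s)) = F (π i, s + m i) := by
    intro σ hσ
    have hz : ∀ s : ZMod 2, s = 0 ∨ s = 1 := by decide
    let p : Fin 3 → Fin 3 := fun i => (F.symm (σ (F (i, 0)))).1
    let m : Fin 3 → ZMod 2 := fun i => (F.symm (σ (F (i, 0)))).2
    have h0 : ∀ i s, σ (F (i, s)) = F (p i, s + m i) := by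
      intro i s
      have e0 : F.symm (σ (F (i, 0))) = (p i, m i) := rfl
      have e1 : (F.symm (σ (F (i, 1)))).1 = p i := (hF σ hσ i).symm
      have e2 : (F.symm (σ (F (i, 1)))).2 = 1 + m i := by
        have hne : (F.symm (σ (F (i, 1)))).2 ≠ m i := by
          intro h
          have h3 : F.symm (σ (F (i, 1))) = F.symm (σ (F (i, 0))) := Prod.ext e1 h
          have h4 := F.injective (σ.injective (F.symm.injective h3))
          simp at h4
        have : ∀ a b : ZMod 2, a ≠ b → a = 1 + b := by decide
        exact this _ _ hne
      rw [← Equiv.symm_apply_eq]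
      rcases hz s with rfl | rfl
      · rw [e0, zero_add]
      · exact Prod.ext e1 e2
    have hp : Function.Surjective p := by
      intro j
      obtain ⟨x, hx⟩ := σ.surjective (F (j, 0))
      obtain ⟨⟨i, s⟩, rfl⟩ := F.surjective x
      rw [h0] at hx
      exact ⟨i, congrArg Prod.fst (F.injective hx)⟩
    exact ⟨m, Equiv.ofBijective p (Finite.surjective_iff_bijective.mp hp), h0⟩
  have hne : ∃ m π, S m π ∧ ∃ i j, m i ≠ m j := by
    by_contra! hcon
    apply hno3
    refine ⟨Set.range fun i => F (i, 0), ?_, ?_⟩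
    · intro g hg
      obtain ⟨m, π, h⟩ := hform g hg
      have hm := hcon m π ⟨g, hg, h⟩
      have hz : m 0 = 0 ∨ m 0 = 1 := by generalize m 0 = x; revert x; decide
      rcases hz with h0 | h0
      · left
        ext x
        constructor
        · rintro ⟨_, ⟨i, rfl⟩, rfl⟩
          refine ⟨π i, ?_⟩
          simp only [h, hm i 0, h0, zero_add]
        · rintro ⟨i, rfl⟩
          refine ⟨_, ⟨π⁻¹ i, rfl⟩, ?_⟩
          simp [h, hm _ 0, h0]
      · right
        rw [Set.disjoint_left]
        rintro _ ⟨_, ⟨i, rfl⟩, rfl⟩ ⟨j, hj⟩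
        simp [h, hm i 0, h0] at hj
    · rw [← Set.image_univ, Set.ncard_image_of_injective, Set.ncard_univ, Nat.card_fin]
      intro i j h
      simpa using h
  refine ⟨F, fun c s => ∃ m π, S m π ∧ ∑ i, m i = c ∧ Equiv.Perm.sign π = s, ?_, ?_, ?_⟩
  · exact ⟨0, 1, ⟨1, L.one_mem, by simp⟩, by simp, by simp⟩
  · rintro c s c' s' ⟨m, π, h, rfl, rfl⟩ ⟨m', π', h', rfl, rfl⟩
    refine ⟨_, _, hmul _ _ _ _ h h', ?_, map_mul _ _ _⟩
    have : ∑ i, m (π' i) = ∑ i, m i := Equiv.sum_comp π' m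
    simp only [Pi.add_apply, Function.comp_apply, Finset.sum_add_distrib, this]
    exact add_comm _ _
  · intro σ
    constructor
    · intro hσ
      obtain ⟨m, π, h⟩ := hform σ hσ
      exact ⟨m, π, ⟨m, π, ⟨σ, hσ, h⟩, rfl, rfl⟩, h⟩
    · rintro ⟨m, π, ⟨m', π', hS, hsum, hsign⟩, h⟩
      obtain ⟨σ', hσ', h'⟩ := wreath_mem_iff S hmul hrot hne hS hsum hsign
      have : σ = σ' := by
        ext x
        obtain ⟨⟨i, s⟩, rfl⟩ := F.surjective x
        rw [h, h']
      rwa [this]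

/-- A connected cubic graph with a proper 3-edge-colouring whose colour-permuting automorphisms
induce every permutation of the colours between any two vertices. The neighbour of `v` along the
edge of colour `i` is `nbr v i`. -/
structure ColouredCubicGraph (V : Type) where
  nbr : V → Fin 3 → V
  nbr_nbr : ∀ v i, nbr (nbr v i) i = v
  nbr_ne : ∀ v i, nbr v i ≠ v
  nbr_injective : ∀ v, Function.Injective (nbr v)
  connected : ∀ P : V → Prop, (∀ v i, P v → P (nbr v i)) → ∀ v w, P v → P w
  flag_transitive : ∀ v w (π : Equiv.Perm (Fin 3)), ∃ h : Equiv.Perm V, h v = w ∧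
    ∀ u i, h (nbr u i) = nbr (h u) (π i)

namespace ColouredCubicGraph

variable {V : Type} (Δ : ColouredCubicGraph V)

/-- The lexicographic product of the cubic graph with two isolated vertices. -/
def doubled : SimpleGraph (V × ZMod 2) where
  Adj x y := ∃ i, y.1 = Δ.nbr x.1 i
  symm := ⟨by
    rintro x y ⟨i, h⟩
    exact ⟨i, by rw [h, Δ.nbr_nbr]⟩⟩
  loopless := ⟨by
    rintro x ⟨i, h⟩
    exact Δ.nbr_ne _ _ h.symm⟩

/-- The binary functions on the vertices summing to zero over each neighbourhood. -/
def code : Set (V → ZMod 2) := {m | ∀ v, ∑ i, m (Δ.nbr v i) = 0}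

/-- The permutation `(v, s) ↦ (h v, s + m v)`. -/
def twist (h : Equiv.Perm V) (m : V → ZMod 2) : Equiv.Perm (V × ZMod 2) where
  toFun x := (h x.1, x.2 + m x.1)
  invFun x := (h.symm x.1, x.2 - m (h.symm x.1))
  left_inv x := by simp
  right_inv x := by simp

@[simp]
theorem twist_apply (h : Equiv.Perm V) (m : V → ZMod 2) (v : V) (s : ZMod 2) :
    twist h m (v, s) = (h v, s + m v) := rfl

/-- `g` lifts a colour-permuting automorphism so that around each vertex the pair
(total flip, sign of the colour permutation) satisfies `Q`. -/
def IsLift (Q : ZMod 2 → ℤˣ → Prop) (g : Equiv.Perm (V × ZMod 2)) : Prop :=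
  ∃ (h : Equiv.Perm V) (m : V → ZMod 2) (π : Equiv.Perm (Fin 3)), g = twist h m ∧
    (∀ u i, h (Δ.nbr u i) = Δ.nbr (h u) (π i)) ∧
    ∀ v, Q (∑ i, m (Δ.nbr v i)) (Equiv.Perm.sign π)

variable {Q : ZMod 2 → ℤˣ → Prop}

theorem IsLift.one (hQ1 : Q 0 1) : Δ.IsLift Q 1 := by
  refine ⟨1, 0, 1, ?_, by simp, fun _ => by simpa using hQ1⟩
  ext x <;> simp [twist]

variable {Δ} in
theorem IsLift.mul (hQm : ∀ c s c' s', Q c s → Q c' s' → Q (c + c') (s * s'))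
    {g g' : Equiv.Perm (V × ZMod 2)} (hg : Δ.IsLift Q g) (hg' : Δ.IsLift Q g') :
    Δ.IsLift Q (g * g') := by
  obtain ⟨h, m, π, rfl, hc, hq⟩ := hg
  obtain ⟨h', m', π', rfl, hc', hq'⟩ := hg'
  refine ⟨h * h', m' + m ∘ h', π * π', ?_, ?_, ?_⟩
  · apply Equiv.ext
    rintro ⟨v, s⟩
    simp [add_assoc]
  · intro u i
    simp [hc, hc']
  · intro v
    have e : ∑ i, m (Δ.nbr (h' v) (π' i)) = ∑ i, m (Δ.nbr (h' v) i) :=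
      Equiv.sum_comp π' fun i => m (Δ.nbr (h' v) i)
    simp only [Pi.add_apply, Function.comp_apply, Finset.sum_add_distrib, hc', e,
      map_mul, add_comm (∑ i, m' (Δ.nbr v i))]
    exact hQm _ _ _ _ (hq _) (hq' _)

/-- The group of all lifts. -/
def liftGroup [Finite V] (hQ1 : Q 0 1)
    (hQm : ∀ c s c' s', Q c s → Q c' s' → Q (c + c') (s * s')) :
    Subgroup (Equiv.Perm (V × ZMod 2)) where
  carrier := {g | Δ.IsLift Q g}
  one_mem' := IsLift.one Δ hQ1
  mul_mem' := fun ha hb => ha.mul hQm hb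
  inv_mem' := by
    intro g hg
    have hpow : ∀ n : ℕ, Δ.IsLift Q (g ^ n) := by
      intro n
      induction n with
      | zero => exact IsLift.one Δ hQ1
      | succ n ih => rw [pow_succ]; exact ih.mul hQm hg
    have hinv : g⁻¹ = g ^ (orderOf g - 1) := by
      apply inv_eq_of_mul_eq_one_left
      rw [← pow_succ, Nat.sub_add_cancel (orderOf_pos g), pow_orderOf_eq_one]
    rw [hinv]
    exact hpow _

/-- The doubled graph with the group of lifts is a locally-`L` pair. -/
theorem isLocallyPair [Finite V] [Nonempty V] {Ω : Type} {L : Subgroup (Equiv.Perm Ω)}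
    (hQ1 : Q 0 1) (hQm : ∀ c s c' s', Q c s → Q c' s' → Q (c + c') (s * s'))
    (F : Fin 3 × ZMod 2 ≃ Ω)
    (hF : ∀ σ : Equiv.Perm Ω, σ ∈ L ↔ ∃ (m : Fin 3 → ZMod 2) (π : Equiv.Perm (Fin 3)),
        Q (∑ i, m i) (Equiv.Perm.sign π) ∧ ∀ i s, σ (F (i, s)) = F (π i, s + m i))
    (hcode : ∀ v a₀ (a : Fin 3 → ZMod 2), ∑ i, a i = 0 →
      ∃ m ∈ Δ.code, m v = a₀ ∧ ∀ i, m (Δ.nbr v i) = a i) :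
    IsLocallyPair Δ.doubled (Δ.liftGroup hQ1 hQm) L where
  connected := by
    have hstep : ∀ v i s s', Δ.doubled.Adj (v, s) (Δ.nbr v i, s') := fun v i _ _ => ⟨i, rfl⟩
    rw [SimpleGraph.connected_iff]
    refine ⟨?_, inferInstance⟩
    rintro ⟨v, s⟩ ⟨w, r⟩
    refine Δ.connected (fun w => ∀ r, Δ.doubled.Reachable (v, s) (w, r)) ?_ v w ?_ r
    · intro u i hu r
      exact (hu 0).trans (hstep _ _ _ _).reachable
    · intro r
      exact (hstep v 0 s 0).reachable.trans (hstep v 0 r 0).symm.reachable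
  le_aut := by
    rintro g ⟨h, m, π, rfl, hc, -⟩ ⟨u, s⟩ ⟨w, r⟩
    constructor
    · rintro ⟨i, hi⟩
      refine ⟨π⁻¹ i, h.injective ?_⟩
      rw [hc]
      simpa using hi
    · rintro ⟨i, hi⟩
      refine ⟨π i, ?_⟩
      simp only [twist_apply] at hi ⊢
      rw [hi, hc]
  arc_trans := by
    rintro ⟨u, s⟩ ⟨v, r⟩ ⟨u', s'⟩ ⟨v', r'⟩ ⟨i, rfl : v = _⟩ ⟨i', rfl : v' = _⟩
    obtain ⟨π, hπ, hsign⟩ : ∃ π : Equiv.Perm (Fin 3), π i = i' ∧ Equiv.Perm.sign π = 1 := by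
      revert i i'; decide
    obtain ⟨h, hu, hc⟩ := Δ.flag_transitive u u' π
    obtain ⟨a, ha, hai⟩ : ∃ a : Fin 3 → ZMod 2, ∑ j, a j = 0 ∧ a i = r' - r := by
      have key : ∀ (i : Fin 3) (x : ZMod 2), ∃ a : Fin 3 → ZMod 2, ∑ j, a j = 0 ∧ a i = x := by
        decide
      exact key i _
    obtain ⟨m, hm, hmu, hmi⟩ := hcode u (s' - s) a ha
    refine ⟨twist h m, ⟨h, m, π, rfl, hc, fun v => ?_⟩, ?_, ?_⟩
    · rw [hm v, hsign]; exact hQ1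
    · simp [hu, hmu]
    · simp [hc, hu, hπ, hmi, hai]
  loc := by
    rintro ⟨v, s⟩
    let E₀ : Fin 3 × ZMod 2 → Δ.doubled.neighborSet (v, s) :=
      fun x => ⟨(Δ.nbr v x.1, x.2), x.1, rfl⟩
    have hE₀ : Function.Bijective E₀ := by
      constructor
      · rintro ⟨i, r⟩ ⟨j, r'⟩ hij
        have h1 := congrArg Subtype.val hij
        simp only [E₀, Prod.mk.injEq] at h1
        exact Prod.ext (Δ.nbr_injective v h1.1) h1.2
      · rintro ⟨⟨w, r⟩, i, hi⟩
        exact ⟨(i, r), Subtype.ext (Prod.ext hi.symm rfl)⟩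
    let E := Equiv.ofBijective E₀ hE₀
    have hE : ∀ i r, (E (i, r) : V × ZMod 2) = (Δ.nbr v i, r) := fun _ _ => rfl
    refine ⟨E.symm.trans F, fun σ => ?_⟩
    have hval : ∀ i r j r', σ (F (i, r)) = F (j, r') ↔
        (((E.symm.trans F).symm (σ ((E.symm.trans F) (E (i, r)))) :
          Δ.doubled.neighborSet (v, s)) : V × ZMod 2) = (Δ.nbr v j, r') := by
      intro i r j r'
      rw [← hE, Subtype.coe_inj]
      simp [Equiv.symm_apply_eq]
    rw [hF]
    constructor
    · rintro ⟨a, π, hQ, hσ⟩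
      obtain ⟨h, hv, hc⟩ := Δ.flag_transitive v v π
      obtain ⟨m, hm, hm0, hma⟩ := hcode v (∑ i, a i) (fun i => a i + ∑ j, a j) (by
        simp only [Finset.sum_add_distrib, Finset.sum_const, Finset.card_univ, Fintype.card_fin]
        generalize ∑ j, a j = x
        revert x; decide)
      refine ⟨twist h (fun w => m w + ∑ i, a i), ⟨h, _, π, rfl, hc, fun w => ?_⟩, ?_, ?_⟩
      · have h1 : ∑ i, (m (Δ.nbr w i) + ∑ i, a i) = ∑ i, a i := by
          rw [Finset.sum_add_distrib, hm w]
          simp only [Finset.sum_const, Finset.card_univ, Fintype.card_fin]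
          generalize ∑ j, a j = x
          revert x; decide
        rw [h1]; exact hQ
      · simp [hv, hm0, CharTwo.add_self_eq_zero]
      · intro w
        obtain ⟨⟨i, r⟩, rfl⟩ := E.surjective w
        rw [(hval _ _ _ _).mp (hσ i r), hE, twist_apply, hc, hv, hma, add_assoc,
          CharTwo.add_self_eq_zero, add_zero]
    · rintro ⟨_, ⟨h, m, π, rfl, hc, hq⟩, hfix, hσ⟩
      have hv : h v = v := congrArg Prod.fst hfix
      refine ⟨fun i => m (Δ.nbr v i), π, hq v, fun i r => ?_⟩
      rw [hval, hσ, hE, twist_apply, hc, hv]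

/-- Codewords vanishing on an edge yield elements of the arc-stabiliser. -/
theorem ncard_code_le_card_aStab [Finite V] (hQ1 : Q 0 1)
    (hQm : ∀ c s c' s', Q c s → Q c' s' → Q (c + c') (s * s')) (v w : V) :
    {m ∈ Δ.code | m v = 0 ∧ m w = 0}.ncard ≤
      Nat.card (aStab (Δ.liftGroup hQ1 hQm) (v, 0) (w, 0)) := by
  rw [← Nat.card_coe_set_eq]
  refine Nat.card_le_card_of_injective (fun m => ⟨twist 1 m.1, ⟨⟨⟨1, m.1, 1, rfl, ?_, ?_⟩, ?_⟩, ?_⟩⟩) ?_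
  · simp
  · intro u
    rw [m.2.1 u, map_one]
    exact hQ1
  · simp [MulAction.mem_stabilizer_iff, m.2.2.1]
  · simp [MulAction.mem_stabilizer_iff, m.2.2.2]
  · intro m m' h
    ext u
    have h1 := congrArg (fun g => (g.1 (u, 0)).2) h
    simpa using h1

variable {Δ} in
theorem code_of_base (v₀ : V)
    (h₀ : ∀ a₀ (a : Fin 3 → ZMod 2), ∑ i, a i = 0 →
      ∃ m ∈ Δ.code, m v₀ = a₀ ∧ ∀ i, m (Δ.nbr v₀ i) = a i)
    (v : V) (a₀ : ZMod 2) (a : Fin 3 → ZMod 2) (ha : ∑ i, a i = 0) :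
    ∃ m ∈ Δ.code, m v = a₀ ∧ ∀ i, m (Δ.nbr v i) = a i := by
  obtain ⟨m, hm, hm₀, hma⟩ := h₀ a₀ a ha
  obtain ⟨h, hv, hc⟩ := Δ.flag_transitive v v₀ 1
  refine ⟨m ∘ h, fun u => ?_, by simp [hv, hm₀], fun i => by simp [hc, hv, hma]⟩
  simpa [hc] using hm (h u)

end ColouredCubicGraph

/-- The ring `𝔽₂[X]/(X² + X + 1)^t` for `t = 2 ^ k`: its root `x` has order dividing `3t`,
`x (1 + x)` has order dividing `t`, and `1, x, …, x ^ (2t - 1)` are linearly independent. -/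
theorem exists_ring (k : ℕ) : ∃ (R : Type) (_ : CommRing R) (x w : Rˣ)
    (ψ : (ℕ → ZMod 2) → R →+ ZMod 2), (2 : R) = 0 ∧ x ^ (3 * 2 ^ k) = 1 ∧ w ^ 2 ^ k = 1 ∧
      (w : R) = x * (1 + x) ∧ ∀ c j, j < 2 * 2 ^ k → ψ c ((x : R) ^ j) = c j := by
  let f : Polynomial (ZMod 2) := .X ^ (2 * 2 ^ k) + (.X ^ 2 ^ k + 1)
  have hpos : 0 < 2 ^ k := by positivity
  have hdeg : (Polynomial.X ^ 2 ^ k + 1 : Polynomial (ZMod 2)).degree < (2 * 2 ^ k : ℕ) := by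
    rw [← Polynomial.C_1, Polynomial.degree_X_pow_add_C hpos]
    exact_mod_cast (by omega : 2 ^ k < 2 * 2 ^ k)
  have hf : f.Monic := Polynomial.monic_X_pow_add hdeg
  have hfdeg : f.natDegree = 2 * 2 ^ k := by
    rw [Polynomial.natDegree_add_eq_left_of_degree_lt, Polynomial.natDegree_X_pow]
    rwa [Polynomial.degree_X_pow]
  let r : AdjoinRoot f := AdjoinRoot.root f
  have h2 : (2 : AdjoinRoot f) = 0 := by
    have : (algebraMap (ZMod 2) (AdjoinRoot f)) 2 = 0 := by
      rw [show (2 : ZMod 2) = 0 from rfl, map_zero]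
    rwa [map_ofNat] at this
  have hr : r ^ (2 * 2 ^ k) + (r ^ 2 ^ k + 1) = 0 := by
    have := AdjoinRoot.mk_self (f := f)
    rwa [map_add, map_add, map_pow, map_pow, map_one, AdjoinRoot.mk_X] at this
  have hfrob : (1 + r) ^ 2 ^ k = 1 + r ^ 2 ^ k := by
    have := congrArg (AdjoinRoot.mk f)
      (add_pow_char_pow (1 : Polynomial (ZMod 2)) Polynomial.X 2 k)
    simpa [r] using this
  have h3 : r ^ (3 * 2 ^ k) = 1 := by
    have e1 : r ^ (2 * 2 ^ k) = (r ^ 2 ^ k) ^ 2 := by rw [← pow_mul, mul_comm]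
    have e2 : r ^ (3 * 2 ^ k) = (r ^ 2 ^ k) ^ 3 := by rw [← pow_mul, mul_comm]
    rw [e1] at hr
    rw [e2]
    linear_combination (r ^ 2 ^ k - 1) * hr
  have hw : (r * (1 + r)) ^ 2 ^ k = 1 := by
    rw [mul_pow, hfrob]
    have e1 : r ^ (2 * 2 ^ k) = (r ^ 2 ^ k) ^ 2 := by rw [← pow_mul, mul_comm]
    rw [e1] at hr
    linear_combination hr - h2
  let B := AdjoinRoot.powerBasis' hf
  refine ⟨AdjoinRoot f, inferInstance, Units.ofPowEqOne r _ h3 (by positivity),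
    Units.ofPowEqOne _ _ hw (by positivity),
    fun c => (B.basis.constr (ZMod 2) fun i => c i).toAddMonoidHom, h2, ?_, ?_, ?_, ?_⟩
  · exact Units.pow_ofPowEqOne _ _
  · exact Units.pow_ofPowEqOne _ _
  · simp
  · intro c j hj
    have hB : B.dim = 2 * 2 ^ k := hfdeg
    have h5 := B.basis.constr_basis (ZMod 2) (fun i => c i) ⟨j, by omega⟩
    rw [PowerBasis.basis_eq_pow] at h5
    exact h5

namespace HoneycombTorus

/-- The step from an even vertex to its odd neighbour of colour `i`. -/
def step (t : ℕ) : Fin 3 → ZMod (3 * t) × ZMod t := ![0, (1, 0), (-1, 1)]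

/-- The neighbour of colour `i` of a vertex of the honeycomb torus. -/
def nbr (t : ℕ) (v : Bool × ZMod (3 * t) × ZMod t) (i : Fin 3) :
    Bool × ZMod (3 * t) × ZMod t :=
  (!v.1, if v.1 then v.2 - step t i else v.2 + step t i)

variable {t : ℕ}

@[simp]
theorem nbr_false (a : ZMod (3 * t) × ZMod t) (i : Fin 3) :
    nbr t (false, a) i = (true, a + step t i) := rfl

@[simp]
theorem nbr_true (a : ZMod (3 * t) × ZMod t) (i : Fin 3) :
    nbr t (true, a) i = (false, a - step t i) := rfl

@[simp]
theorem step_zero : step t 0 = 0 := rfl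

@[simp]
theorem step_one : step t 1 = (1, 0) := rfl

@[simp]
theorem step_two : step t 2 = (-1, 1) := rfl

theorem nbr_nbr (v : Bool × ZMod (3 * t) × ZMod t) (i : Fin 3) : nbr t (nbr t v i) i = v := by
  rcases v with ⟨_ | _, a⟩ <;> simp

theorem step_injective (ht : 0 < t) : Function.Injective (step t) := by
  have : Fact (2 < 3 * t) := ⟨by omega⟩
  have : Fact (1 < 3 * t) := ⟨by omega⟩
  have h1 : (1 : ZMod (3 * t)) ≠ 0 := one_ne_zero
  have h2 : (-1 : ZMod (3 * t)) ≠ 1 := ZMod.neg_one_ne_one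
  intro i j h
  have h' := congrArg Prod.fst h
  match i, j with
  | 0, 0 | 1, 1 | 2, 2 => rfl
  | 0, 1 | 1, 0 => simp at h'
  | 0, 2 | 2, 0 => simp at h'
  | 1, 2 => exact (h2 h'.symm).elim
  | 2, 1 => exact (h2 h').elim

theorem connected (ht : 0 < t) (P : Bool × ZMod (3 * t) × ZMod t → Prop)
    (hP : ∀ v i, P v → P (nbr t v i)) (v w : Bool × ZMod (3 * t) × ZMod t) (hv : P v) : P w := by
  have : NeZero t := ⟨ht.ne'⟩
  have : NeZero (3 * t) := ⟨by omega⟩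
  let T : AddSubmonoid (ZMod (3 * t) × ZMod t) :=
    { carrier := {a | ∀ b, P (false, b) → P (false, b + a)}
      zero_mem' := by simp
      add_mem' := by
        intro a a' ha ha' b hb
        rw [← add_assoc]
        exact ha' _ (ha _ hb) }
  have hT : ∀ i, step t i ∈ T := by
    intro i b hb
    have := hP _ 0 (hP _ i hb)
    simpa [step] using this
  have h1 : ((1, 0) : ZMod (3 * t) × ZMod t) ∈ T := hT 1
  have h2 : ((0, 1) : ZMod (3 * t) × ZMod t) ∈ T := by
    simpa [step] using T.add_mem (hT 1) (hT 2)
  have hall : ∀ a, a ∈ T := by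
    rintro ⟨p, q⟩
    have := T.add_mem (T.nsmul_mem h1 p.val) (T.nsmul_mem h2 q.val)
    simpa using this
  have hfalse : ∀ a, P (false, a) := by
    obtain ⟨b, hb⟩ : ∃ b, P (false, b) := by
      rcases v with ⟨_ | _, a⟩
      · exact ⟨a, hv⟩
      · exact ⟨_, hP _ 0 hv⟩
    intro a
    have := hall (a - b) b hb
    simpa using this
  rcases w with ⟨_ | _, a⟩
  · exact hfalse a
  · simpa [step] using hP _ 0 (hfalse a)

/-- `π` is induced on the colours by a map of the honeycomb torus. -/
def IsColourMap (t : ℕ) (h : Bool × ZMod (3 * t) × ZMod t → Bool × ZMod (3 * t) × ZMod t)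
    (π : Equiv.Perm (Fin 3)) : Prop :=
  ∀ u i, h (nbr t u i) = nbr t (h u) (π i)

theorem IsColourMap.comp {h h' : Bool × ZMod (3 * t) × ZMod t → Bool × ZMod (3 * t) × ZMod t}
    {π π' : Equiv.Perm (Fin 3)} (hh : IsColourMap t h π) (hh' : IsColourMap t h' π') :
    IsColourMap t (h ∘ h') (π * π') := fun u i => by
  simp [hh' u i, hh (h' u) (π' i)]

theorem exists_isColourMap_affine (α : ZMod (3 * t) × ZMod t →+ ZMod (3 * t) × ZMod t)
    (c : ZMod (3 * t) × ZMod t) (π : Equiv.Perm (Fin 3))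
    (hα : ∀ i, α (step t i) + c = step t (π i)) : ∃ h, IsColourMap t h π := by
  refine ⟨fun v => (v.1, α v.2 + if v.1 then c else 0), ?_⟩
  rintro ⟨_ | _, a⟩ i
  · simp [← hα, add_assoc]
  · simp [← hα]

theorem exists_isColourMap (π : Equiv.Perm (Fin 3)) : ∃ h, IsColourMap t h π := by
  let κ : ZMod (3 * t) →+ ZMod t := (ZMod.castHom (Dvd.intro_left 3 rfl) (ZMod t)).toAddMonoidHom
  have hκ : κ 1 = 1 := map_one (ZMod.castHom (Dvd.intro_left 3 rfl) (ZMod t))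
  let θ : ZMod t →+ ZMod (3 * t) := ZMod.lift t ⟨zmultiplesHom _ 3, by
    have := ZMod.natCast_self (3 * t)
    push_cast at this
    simp [mul_comm _ (3 : ZMod (3 * t)), this]⟩
  have hθ : θ 1 = 3 := by
    have := ZMod.lift_coe t ⟨zmultiplesHom (ZMod (3 * t)) 3, by
      have := ZMod.natCast_self (3 * t)
      push_cast at this
      simp [mul_comm _ (3 : ZMod (3 * t)), this]⟩ 1
    simpa using this
  let p := AddMonoidHom.fst (ZMod (3 * t)) (ZMod t)
  let q := AddMonoidHom.snd (ZMod (3 * t)) (ZMod t)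
  have hrot : ∃ h, IsColourMap t h (finRotate 3) := by
    refine exists_isColourMap_affine
      ((-(p + p) - θ.comp q).prod (κ.comp p + q)) (step t 1) _ fun i => ?_
    have h0 : finRotate 3 0 = 1 := by decide
    have h1 : finRotate 3 1 = 2 := by decide
    have h2 : finRotate 3 2 = 0 := by decide
    match i with
    | 0 => simp [h0]
    | 1 => simp [h1, p, q, hκ]
    | 2 => simp [h2, p, q, hκ, hθ]; norm_num
  have hswap : ∃ h, IsColourMap t h (Equiv.swap 1 2) := by
    refine exists_isColourMap_affine ((-p).prod (κ.comp p + q)) 0 _ fun i => ?_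
    match i with
    | 0 => simp [Equiv.swap_apply_of_ne_of_ne]
    | 1 => simp [p, q, hκ]
    | 2 => simp [p, q, hκ]
  obtain ⟨hr, hhr⟩ := hrot
  obtain ⟨hs, hhs⟩ := hswap
  have key : ∀ π : Equiv.Perm (Fin 3), π = 1 ∨ π = finRotate 3 ∨ π = finRotate 3 * finRotate 3 ∨
      π = Equiv.swap 1 2 ∨ π = finRotate 3 * Equiv.swap 1 2 ∨
      π = finRotate 3 * (finRotate 3 * Equiv.swap 1 2) := by
    decide
  rcases key π with rfl | rfl | rfl | rfl | rfl | rfl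
  · exact ⟨id, fun _ _ => rfl⟩
  · exact ⟨_, hhr⟩
  · exact ⟨_, hhr.comp hhr⟩
  · exact ⟨_, hhs⟩
  · exact ⟨_, hhr.comp hhs⟩
  · exact ⟨_, hhr.comp (hhr.comp hhs)⟩

theorem exists_isColourMap_one (v w : Bool × ZMod (3 * t) × ZMod t) :
    ∃ h, IsColourMap t h 1 ∧ h v = w := by
  have htr : ∀ c, IsColourMap t (fun v => (v.1, v.2 + c)) 1 := by
    rintro c ⟨_ | _, a⟩ i
    · simp [add_right_comm]
    · simp [sub_add_eq_add_sub]
  have hsw : IsColourMap t (fun v => (!v.1, -v.2)) 1 := by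
    rintro ⟨_ | _, a⟩ i
    · simp; abel
    · simp; abel
  obtain ⟨b, a⟩ := v
  obtain ⟨b', a'⟩ := w
  by_cases hb : b = b'
  · exact ⟨_, htr (a' - a), by simp [hb]⟩
  · refine ⟨_, (htr (a' + a)).comp hsw, ?_⟩
    revert hb
    cases b <;> cases b' <;> simp

/-- The honeycomb graph on the torus `ℤ[ω] / (√-3 t)`. -/
def graph (t : ℕ) (ht : 0 < t) : ColouredCubicGraph (Bool × ZMod (3 * t) × ZMod t) where
  nbr := nbr t
  nbr_nbr := nbr_nbr
  nbr_ne v i h := by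
    have := congrArg Prod.fst h
    simp [nbr] at this
  nbr_injective v i j h := by
    rcases v with ⟨_ | _, a⟩
    · simpa [(step_injective ht).eq_iff] using h
    · simpa [(step_injective ht).eq_iff] using h
  connected := connected ht
  flag_transitive v w π := by
    have : NeZero t := ⟨ht.ne'⟩
    have : NeZero (3 * t) := ⟨by omega⟩
    obtain ⟨h₁, hh₁⟩ := exists_isColourMap (t := t) π
    obtain ⟨h₂, hh₂, hw⟩ := exists_isColourMap_one (h₁ v) w
    have hh := hh₂.comp hh₁
    rw [one_mul] at hh
    have hsurj : Function.Surjective (h₂ ∘ h₁) := by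
      intro u
      refine connected ht (fun u => ∃ x, (h₂ ∘ h₁) x = u) ?_ _ u ⟨v, rfl⟩
      rintro _ i ⟨x, rfl⟩
      refine ⟨nbr t x (π⁻¹ i), ?_⟩
      rw [hh]
      simp
    exact ⟨Equiv.ofBijective _ (Finite.surjective_iff_bijective.mp hsurj), hw, hh⟩

/-- A family of codewords on the honeycomb torus with `t = 2 ^ k`, parametrised by
the values on two lines of `2t` vertices. -/
theorem exists_codeword (k : ℕ) (ht : 0 < 2 ^ k) (c d : ℕ → ZMod 2) :
    ∃ m ∈ (graph (2 ^ k) ht).code,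
      (∀ j : ℕ, j < 2 * 2 ^ k → m (true, (j, 0)) = c j) ∧
      ∀ j : ℕ, j < 2 * 2 ^ k → m (false, (-j, 0)) = d j := by
  obtain ⟨R, _, x, w, ψ, h2, hx, hw, hwx, hψ⟩ := exists_ring k
  let X : ZMod (3 * 2 ^ k) →+ Additive Rˣ :=
    ZMod.lift _ ⟨zmultiplesHom _ (Additive.ofMul x), by
      simp only [zmultiplesHom_apply, natCast_zsmul]
      rw [← ofMul_pow, hx, ofMul_one]⟩
  let W : ZMod (2 ^ k) →+ Additive Rˣ :=
    ZMod.lift _ ⟨zmultiplesHom _ (Additive.ofMul w), by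
      simp only [zmultiplesHom_apply, natCast_zsmul]
      rw [← ofMul_pow, hw, ofMul_one]⟩
  have hX : ∀ j : ℕ, X j = Additive.ofMul (x ^ j) := by
    intro j
    have := ZMod.lift_coe (3 * 2 ^ k) ⟨zmultiplesHom _ (Additive.ofMul x), by
      simp only [zmultiplesHom_apply, natCast_zsmul]
      rw [← ofMul_pow, hx, ofMul_one]⟩ (j : ℤ)
    simpa using this
  have hW : W 1 = Additive.ofMul w := by
    have := ZMod.lift_coe (2 ^ k) ⟨zmultiplesHom _ (Additive.ofMul w), by
      simp only [zmultiplesHom_apply, natCast_zsmul]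
      rw [← ofMul_pow, hw, ofMul_one]⟩ 1
    simpa using this
  let ξ : ZMod (3 * 2 ^ k) × ZMod (2 ^ k) → R := fun a => ((X a.1 + W a.2).toMul : Rˣ)
  have hξadd : ∀ a b, ξ (a + b) = ξ a * ξ b := by
    intro a b
    simp only [ξ, Prod.fst_add, Prod.snd_add, map_add, ← Units.val_mul, ← toMul_add]
    congr 2
    abel
  have hξx : ∀ j : ℕ, ξ (j, 0) = (x : R) ^ j := by
    intro j
    simp [ξ, hX]
  have hξ0 : ξ (step (2 ^ k) 0) = 1 := by simp [ξ, step]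
  have hX1 : X 1 = Additive.ofMul x := by simpa using hX 1
  have hξ1 : ξ (step (2 ^ k) 1) = x := by simp [ξ, step, hX1]
  have hξ2 : ξ (step (2 ^ k) 2) = 1 + x := by
    simp [ξ, step, hX1, hW, hwx]
  have hsum : ξ (step (2 ^ k) 0) + ξ (step (2 ^ k) 1) + ξ (step (2 ^ k) 2) = 0 := by
    rw [hξ0, hξ1, hξ2]
    linear_combination (1 + (x : R)) * h2
  have hsum' : ∀ (e : ℕ → ZMod 2) a, ψ e (ξ (a + step (2 ^ k) 0)) + ψ e (ξ (a + step (2 ^ k) 1)) +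
      ψ e (ξ (a + step (2 ^ k) 2)) = 0 := by
    intro e a
    rw [← map_add, ← map_add, hξadd, hξadd, hξadd, ← mul_add, ← mul_add, hsum, mul_zero, map_zero]
  refine ⟨fun v => if v.1 then ψ c (ξ v.2) else ψ d (ξ (-v.2)), ?_, ?_, ?_⟩
  · rintro ⟨_ | _, a⟩
    · rw [Fin.sum_univ_three]
      exact hsum' c a
    · rw [Fin.sum_univ_three]
      have h (i : Fin 3) : -(a - step (2 ^ k) i) = -a + step (2 ^ k) i := by abel
      simp only [graph, nbr_true, Bool.false_eq_true, if_false, h]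
      exact hsum' d (-a)
  · intro j hj
    simp [hξx, hψ c j hj]
  · intro j hj
    simp [hξx, hψ d j hj]

end HoneycombTorus

namespace HoneycombTorus

theorem code_at_origin (k : ℕ) (ht : 0 < 2 ^ k) (a₀ : ZMod 2) (a : Fin 3 → ZMod 2)
    (ha : ∑ i, a i = 0) : ∃ m ∈ (graph (2 ^ k) ht).code, m (false, 0) = a₀ ∧
      ∀ i, m ((graph (2 ^ k) ht).nbr (false, 0) i) = a i := by
  obtain ⟨m, hm, hc, hd⟩ := exists_codeword k ht (fun j => if j = 0 then a 0 else a 1) (fun _ => a₀)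
  have h0 : m (true, (0, 0)) = a 0 := by simpa using hc 0 (by omega)
  have h1 : m (true, (1, 0)) = a 1 := by simpa using hc 1 (by omega)
  have hsum := hm (false, 0)
  refine ⟨m, hm, by simpa [Prod.mk_zero_zero] using hd 0 (by omega), fun i => ?_⟩
  rw [Fin.sum_univ_three] at ha hsum
  simp only [graph, nbr_false, zero_add, step_zero, step_one] at hsum ⊢
  rw [h1, show m (true, 0) = a 0 from h0] at hsum
  match i with
  | 0 => exact h0
  | 1 => exact h1
  | 2 => exact add_left_cancel (hsum.trans ha.symm)

theorem le_ncard_code (k : ℕ) (ht : 0 < 2 ^ k) :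
    4 ^ (2 * 2 ^ k - 1) ≤
      {m ∈ (graph (2 ^ k) ht).code | m (false, 0) = 0 ∧ m (true, 0) = 0}.ncard := by
  have : NeZero (2 ^ k) := ⟨ht.ne'⟩
  have : NeZero (3 * 2 ^ k) := ⟨by omega⟩
  let N := 2 * 2 ^ k - 1
  let ext : (Fin N → ZMod 2) → ℕ → ZMod 2 := fun c j =>
    if h : j - 1 < N then (if j = 0 then 0 else c ⟨j - 1, h⟩) else 0
  have hext0 : ∀ c, ext c 0 = 0 := by intro c; simp [ext]
  have hext : ∀ c (j : Fin N), ext c (j + 1) = c j := by intro c j; simp [ext]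
  have hex := fun x : (Fin N → ZMod 2) × (Fin N → ZMod 2) =>
    exists_codeword k ht (ext x.1) (ext x.2)
  choose m hm hc hd using hex
  have hinj : Function.Injective fun x =>
      (⟨m x, hm x, by simpa [hext0, Prod.mk_zero_zero] using hd x 0 (by omega),
        by simpa [hext0, Prod.mk_zero_zero] using hc x 0 (by omega)⟩ :
        {m ∈ (graph (2 ^ k) ht).code | m (false, 0) = 0 ∧ m (true, 0) = 0}) := by
    intro x y hxy
    have hxy' : m x = m y := congrArg Subtype.val hxy
    have hN : ∀ j : Fin N, (j : ℕ) + 1 < 2 * 2 ^ k := fun j => by omega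
    refine Prod.ext (funext fun j => ?_) (funext fun j => ?_)
    · rw [← hext x.1, ← hext y.1, ← hc x _ (hN j), ← hc y _ (hN j), hxy']
    · rw [← hext x.2, ← hext y.2, ← hd x _ (hN j), ← hd y _ (hN j), hxy']
  have hcard := Nat.card_le_card_of_injective _ hinj
  rw [Nat.card_coe_set_eq] at hcard
  refine le_trans (le_of_eq ?_) hcard
  simp [N, ← mul_pow]

end HoneycombTorus

theorem inSubexpClass_four_rpow_sqrt :
    InSubexpClass (fun n => (4 : ℝ) ^ (Real.sqrt ((n : ℝ) / 3) - 1)) := by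
  have h4 : 0 < Real.log 4 := Real.log_pos (by norm_num)
  have hlog : ∀ n : ℕ, Real.log ((4 : ℝ) ^ (Real.sqrt ((n : ℝ) / 3) - 1)) =
      (Real.sqrt n / Real.sqrt 3 - 1) * Real.log 4 := by
    intro n
    rw [Real.log_rpow (by norm_num), Real.sqrt_div (Nat.cast_nonneg n)]
  constructor
  · intro C
    simp only [hlog]
    have h3 : 0 < Real.sqrt 3 := by positivity
    have hlim : Filter.Tendsto (fun n : ℕ => Real.log n / Real.sqrt n) Filter.atTop (nhds 0) := by
      have := (isLittleO_log_rpow_atTop (r := 1 / 2) (by norm_num)).tendsto_div_nhds_zero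
      simp only [← Real.sqrt_eq_rpow] at this
      exact this.comp tendsto_natCast_atTop_atTop
    have hsq : Filter.Tendsto (fun n : ℕ => Real.sqrt n) Filter.atTop Filter.atTop :=
      Real.tendsto_sqrt_atTop.comp tendsto_natCast_atTop_atTop
    have hδ : 0 < Real.log 4 / (2 * Real.sqrt 3 * (|C| + 1)) := by positivity
    obtain ⟨n, h1, h2, h5⟩ := ((hlim.eventually (gt_mem_nhds hδ)).and
      ((hsq.eventually_ge_atTop (2 * Real.sqrt 3)).and (Filter.eventually_ge_atTop 2))).exists
    refine ⟨n, ?_⟩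
    have hn : 0 < Real.log n := Real.log_pos (by exact_mod_cast h5)
    have hsn : 0 < Real.sqrt n := lt_of_lt_of_le (by positivity) h2
    rw [lt_div_iff₀ hn]
    rw [div_lt_div_iff₀ hsn (by positivity)] at h1
    have h6 : Real.sqrt n / (2 * Real.sqrt 3) ≤ Real.sqrt n / Real.sqrt 3 - 1 := by
      rw [div_sub_one h3.ne', div_le_div_iff₀ (by positivity) h3]
      nlinarith
    have h7 : Real.log n * (|C| + 1) < Real.sqrt n / (2 * Real.sqrt 3) * Real.log 4 := by
      rw [div_mul_eq_mul_div, lt_div_iff₀ (by positivity)]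
      linarith
    have h8 : C * Real.log n ≤ Real.log n * (|C| + 1) := by
      nlinarith [le_abs_self C]
    have h9 := mul_le_mul_of_nonneg_right h6 h4.le
    linarith
  · simp only [hlog]
    have h1 : Filter.Tendsto (fun n : ℕ => (Real.sqrt n)⁻¹) Filter.atTop (nhds 0) :=
      (Real.tendsto_sqrt_atTop.comp tendsto_natCast_atTop_atTop).inv_tendsto_atTop
    have h2 : Filter.Tendsto (fun n : ℕ => ((n : ℝ))⁻¹) Filter.atTop (nhds 0) :=
      tendsto_natCast_atTop_atTop.inv_tendsto_atTop
    have h3 := ((h1.div_const (Real.sqrt 3)).sub h2).mul_const (Real.log 4)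
    simp only [zero_div, sub_zero, zero_mul] at h3
    refine h3.congr fun n => ?_
    have h5 : (Real.sqrt n)⁻¹ = Real.sqrt n / n := by
      rw [Real.sqrt_div_self', one_div]
    rw [h5]
    ring

/-- Let `L` be a transitive permutation group of degree 6 that is imprimitive
but admits no system of imprimitivity consisting of two blocks (of size 3). Then `L` is
`f`-graph-unrestrictive for `f(n) = 4^{√(n/3)-1}`; in particular it is
Subexp-graph-unrestrictive. -/
theorem statement13 {Ω : Type} [Fintype Ω] (L : Subgroup (Equiv.Perm Ω))
    (hdeg : Fintype.card Ω = 6) (hL : IsTransPerm L)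
    (himpr : ∃ C : Set Ω, IsBlockOf L C ∧ 1 < C.ncard ∧ C.ncard < 6)
    (hno3 : ¬ ∃ C : Set Ω, IsBlockOf L C ∧ C.ncard = 3) :
    FGraphUnrestrictive L (fun n => (4 : ℝ) ^ (Real.sqrt ((n : ℝ) / 3) - 1)) ∧
    ∃ f : ℕ → ℝ, InSubexpClass f ∧ FGraphUnrestrictive L f := by
  have hunr : FGraphUnrestrictive L (fun n => (4 : ℝ) ^ (Real.sqrt ((n : ℝ) / 3) - 1)) := by
    intro n
    obtain ⟨F, Q, hQ1, hQm, hF⟩ := exists_wreath_description L hdeg hL himpr hno3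
    have ht : 0 < 2 ^ n := by positivity
    have : NeZero (2 ^ n) := ⟨ht.ne'⟩
    have : NeZero (3 * 2 ^ n) := ⟨by omega⟩
    let Δ := HoneycombTorus.graph (2 ^ n) ht
    have hpair := Δ.isLocallyPair hQ1 hQm F hF
      (Δ.code_of_base (false, 0) (HoneycombTorus.code_at_origin n ht))
    have hcard : Fintype.card ((Bool × ZMod (3 * 2 ^ n) × ZMod (2 ^ n)) × ZMod 2) =
        3 * (2 * 2 ^ n) ^ 2 := by
      simp only [Fintype.card_prod, Fintype.card_bool, ZMod.card]
      ring
    refine ⟨_, inferInstance, Δ.doubled, _, ((false, 0), 0), ((true, 0), 0), hpair, ?_,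
      ⟨0, ?_⟩, ?_⟩
    · rw [hcard]
      have := Nat.lt_two_pow_self (n := n)
      nlinarith
    · simp [Δ, HoneycombTorus.graph]
    · have hle := (HoneycombTorus.le_ncard_code n ht).trans
        (Δ.ncard_code_le_card_aStab hQ1 hQm _ _)
      refine le_trans (le_of_eq ?_) (Nat.cast_le.mpr hle)
      have hexp : ((2 * 2 ^ n - 1 : ℕ) : ℝ) = 2 * 2 ^ n - 1 := by
        rw [Nat.cast_sub (by omega)]
        push_cast
        rfl
      rw [hcard, Nat.cast_pow, ← Real.rpow_natCast, hexp]
      push_cast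
      rw [mul_div_cancel_left₀ _ (by norm_num), Real.sqrt_sq (by positivity)]
  exact ⟨hunr, _, inSubexpClass_four_rpow_sqrt, hunr⟩
end

section
/- The dihedral group D_6 of order 12, in its natural transitive action on 6 points, is f-graph-unrestrictive for f(n) = n^α for every real α with 0 < α < log 2 / log 3; in particular, D_6 is Pol-graph-unrestrictive. -/
/-- The dihedral group of order 12 in its natural action on 6 points, generated by the
rotation `x ↦ x + 1` and the reflection `x ↦ -x` of `ZMod 6`. -/
def D6 : Subgroup (Equiv.Perm (ZMod 6)) :=
  Subgroup.closure {Equiv.addLeft (1 : ZMod 6), Equiv.neg (ZMod 6)}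

namespace HexWreath

/-- The sign `1` or `-1` in `ZMod r` attached to a parity. -/
def sgn (r : ℕ) (ε : ZMod 2) : ZMod r := if ε = 0 then 1 else -1

lemma sgn_add (r : ℕ) (ε c : ZMod 2) : sgn r (ε + c) = sgn r ε * sgn r c := by
  have h : ∀ x : ZMod 2, x = 0 ∨ x = 1 := by decide
  have h2 : (1 + 1 : ZMod 2) = 0 := by decide
  rcases h ε with rfl | rfl <;> rcases h c with rfl | rfl <;> simp [sgn, h2]

lemma sgn_add_one (r : ℕ) (ε : ZMod 2) : sgn r (ε + 1) = -sgn r ε := by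
  rw [sgn_add]; simp [sgn]

lemma add_add_self (ε c : ZMod 2) : ε + c + c = ε := by
  rw [add_assoc, CharTwo.add_self_eq_zero, add_zero]

lemma sgn_ne_zero {r : ℕ} (hr : 3 ≤ r) (ε : ZMod 2) : sgn r ε ≠ 0 := by
  have : Fact (1 < r) := ⟨by omega⟩
  unfold sgn
  split_ifs <;> simp

lemma sgn_injective {r : ℕ} (hr : 3 ≤ r) : Function.Injective (sgn r) := by
  have : Fact (2 < r) := ⟨by omega⟩
  have h : ∀ x : ZMod 2, x = 0 ∨ x = 1 := by decide
  have h1 : (-1 : ZMod r) ≠ 1 := ZMod.neg_one_ne_one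
  intro a b hab
  rcases h a with rfl | rfl <;> rcases h b with rfl | rfl
  · rfl
  · exact absurd hab.symm (by simpa [sgn] using h1)
  · exact absurd hab (by simpa [sgn] using h1)
  · rfl

/-- The function `y` with its value at `j` erased. -/
def erase {r : ℕ} (j : ZMod r) (y : ZMod r → ZMod 3) : ZMod r → Option (ZMod 3) :=
  fun i => if i = j then none else some (y i)

/-- The vertices: functions `ZMod r → ZMod 3` defined at all but one point. -/
def Vert (r : ℕ) : Type := {f : ZMod r → Option (ZMod 3) // ∃ j y, f = erase j y}

/-- The vertex obtained from a function by erasing its value at `j`. -/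
def mk {r : ℕ} (j : ZMod r) (y : ZMod r → ZMod 3) : Vert r := ⟨erase j y, j, y, rfl⟩

lemma exists_eq_mk {r : ℕ} (v : Vert r) : ∃ j y, v = mk j y := by
  obtain ⟨f, j, y, rfl⟩ := v
  exact ⟨j, y, rfl⟩

lemma mk_eq_mk {r : ℕ} {j k : ZMod r} {y z : ZMod r → ZMod 3} :
    mk j y = mk k z ↔ j = k ∧ ∀ i, i ≠ j → y i = z i := by
  constructor
  · intro h
    have h' : ∀ i, erase j y i = erase k z i := fun i => congrFun (congrArg Subtype.val h) i
    have hjk : j = k := by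
      by_contra hne
      have := h' j
      simp [erase, hne] at this
    subst hjk
    refine ⟨rfl, fun i hi => ?_⟩
    have := h' i
    simpa [erase, hi] using this
  · rintro ⟨rfl, h⟩
    apply Subtype.ext
    funext i
    by_cases hi : i = j
    · simp [mk, erase, hi]
    · simp [mk, erase, hi, h i hi]

lemma mk_update {r : ℕ} (j : ZMod r) (y : ZMod r → ZMod 3) (a : ZMod 3) :
    mk j (Function.update y j a) = mk j y :=
  mk_eq_mk.2 ⟨rfl, fun _ hi => Function.update_of_ne hi _ _⟩

/-- The graph on `Vert r`: fill the gap of a vertex, then erase the value at a cyclically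
neighbouring position. -/
def graph {r : ℕ} (hr : 3 ≤ r) : SimpleGraph (Vert r) where
  Adj u w := ∃ j ε y, u = mk j y ∧ w = mk (j + sgn r ε) y
  symm := ⟨by
    rintro u w ⟨j, ε, y, rfl, rfl⟩
    refine ⟨_, ε + 1, y, rfl, ?_⟩
    rw [sgn_add_one, add_neg_cancel_right]⟩
  loopless := ⟨by
    rintro u ⟨j, ε, y, rfl, h⟩
    exact sgn_ne_zero hr ε (by simpa using (mk_eq_mk.1 h).1)⟩

lemma graph_adj {r : ℕ} (hr : 3 ≤ r) (j : ZMod r) (ε : ZMod 2) (y : ZMod r → ZMod 3) :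
    (graph hr).Adj (mk j y) (mk (j + sgn r ε) y) := ⟨j, ε, y, rfl, rfl⟩

/-- The permutation `d` of `ZMod r` is dihedral with orientation `c`. -/
def IsDihedral {r : ℕ} (d : Equiv.Perm (ZMod r)) (c : ZMod 2) : Prop :=
  ∀ i ε, d (i + sgn r ε) = d i + sgn r (ε + c)

lemma exists_dihedral {r : ℕ} (j k : ZMod r) (c : ZMod 2) :
    ∃ d : Equiv.Perm (ZMod r), IsDihedral d c ∧ d j = k := by
  have hs : sgn r c * sgn r c = 1 := by
    rw [← sgn_add, CharTwo.add_self_eq_zero]; simp [sgn]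
  refine ⟨⟨fun i => k + (i - j) * sgn r c, fun i => j + (i - k) * sgn r c, ?_, ?_⟩, ?_, ?_⟩
  · intro i
    linear_combination (i - j) * hs
  · intro i
    linear_combination (i - k) * hs
  · intro i ε
    simp only [Equiv.coe_fn_mk, sgn_add]
    ring
  · simp

/-- The permutation `g` acts as the position permutation `d` followed by the value
permutations `τ`. -/
def Acts {r : ℕ} (g : Equiv.Perm (Vert r)) (τ : ZMod r → Equiv.Perm (ZMod 3))
    (d : Equiv.Perm (ZMod r)) : Prop :=
  ∀ j y, g (mk j y) = mk (d j) (fun i => τ i (y (d.symm i)))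

lemma exists_acts {r : ℕ} [NeZero r] (τ : ZMod r → Equiv.Perm (ZMod 3))
    (d : Equiv.Perm (ZMod r)) : ∃ g : Equiv.Perm (Vert r), Acts g τ d := by
  have key (j : ZMod r) (y : ZMod r → ZMod 3) :
      (fun i => (erase j y (d.symm i)).map (τ i)) =
        erase (d j) (fun i => τ i (y (d.symm i))) := by
    funext i
    by_cases hi : i = d j
    · simp [erase, hi]
    · have : d.symm i ≠ j := fun h => hi (by rw [← h]; simp)
      simp [erase, hi, this]
  let F : Vert r → Vert r := fun v => ⟨fun i => (v.1 (d.symm i)).map (τ i), by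
    obtain ⟨f, j, y, rfl⟩ := v
    exact ⟨_, _, key j y⟩⟩
  have : Finite (Vert r) := Subtype.finite
  have hF : Function.Injective F := by
    intro u v h
    apply Subtype.ext
    funext i
    have := congrFun (congrArg Subtype.val h) (d i)
    simp only [F, Equiv.symm_apply_apply] at this
    exact Option.map_injective (τ (d i)).injective this
  exact ⟨Equiv.ofBijective F (Finite.injective_iff_bijective.1 hF),
    fun j y => Subtype.ext (key j y)⟩

/-- The wreath product of `Perm (ZMod 3)` by the dihedral group on `ZMod r`, acting on
`Vert r`. -/
def group (r : ℕ) : Subgroup (Equiv.Perm (Vert r)) where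
  carrier := {g | ∃ τ d c, IsDihedral d c ∧ Acts g τ d}
  one_mem' := ⟨1, 1, 0, fun i ε => by simp, fun j y => rfl⟩
  mul_mem' := by
    rintro g h ⟨τ, d, c, hd, hg⟩ ⟨τ', d', c', hd', hh⟩
    refine ⟨fun i => τ i * τ' (d.symm i), d * d', c' + c, fun i ε => ?_, fun j y => ?_⟩
    · simp only [Equiv.Perm.mul_apply, hd' i ε, hd (d' i), add_assoc]
    · rw [Equiv.Perm.mul_apply, hh, hg]
      rfl
  inv_mem' := by
    rintro g ⟨τ, d, c, hd, hg⟩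
    refine ⟨fun i => (τ (d i))⁻¹, d⁻¹, c, fun i ε => ?_, fun j y => ?_⟩
    · apply d.injective
      rw [hd]
      simp [add_add_self]
    · apply g.injective
      rw [hg]
      simp [Equiv.Perm.inv_def]

lemma group_adj {r : ℕ} (hr : 3 ≤ r) {g : Equiv.Perm (Vert r)} (hg : g ∈ group r)
    {u w : Vert r} (h : (graph hr).Adj u w) : (graph hr).Adj (g u) (g w) := by
  obtain ⟨τ, d, c, hd, hg⟩ := hg
  obtain ⟨j, ε, y, rfl, rfl⟩ := h
  rw [hg, hg, hd]
  exact graph_adj hr _ _ _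

lemma group_le_aut {r : ℕ} (hr : 3 ≤ r) : group r ≤ (graph hr).autSubgroup := by
  intro g hg u w
  refine ⟨fun h => ?_, group_adj hr hg⟩
  simpa using group_adj hr (inv_mem hg) h

lemma isArcTransitive {r : ℕ} [NeZero r] (hr : 3 ≤ r) :
    IsArcTransitive (graph hr) (group r) := by
  rintro u v u' v' ⟨j, ε, y, rfl, rfl⟩ ⟨j', ε', y', rfl, rfl⟩
  obtain ⟨d, hd, rfl⟩ := exists_dihedral j j' (ε + ε')
  obtain ⟨g, hg⟩ := exists_acts (fun i => Equiv.swap (y (d.symm i)) (y' i)) d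
  have hε : ε + (ε + ε') = ε' := by
    rw [← add_assoc, CharTwo.add_self_eq_zero, zero_add]
  refine ⟨g, ⟨_, d, _, hd, hg⟩, ?_, ?_⟩ <;> rw [hg] <;>
    simp [hd j, hε, Equiv.swap_apply_left]

lemma connected {r : ℕ} [NeZero r] (hr : 3 ≤ r) : (graph hr).Connected := by
  have move (y : ZMod r → ZMod 3) (j : ZMod r) (n : ℕ) :
      (graph hr).Reachable (mk j y) (mk (j + n) y) := by
    induction n with
    | zero => simp
    | succ n ih =>
      refine ih.trans (SimpleGraph.Adj.reachable ?_)
      have := graph_adj hr (j + n) 0 y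
      simpa [sgn, add_assoc] using this
  have move' (y : ZMod r → ZMod 3) (j k : ZMod r) :
      (graph hr).Reachable (mk j y) (mk k y) := by
    have := move y j (k - j).val
    simpa using this
  have change (y z : ZMod r → ZMod 3) (j : ZMod r) (s : Finset (ZMod r)) :
      (graph hr).Reachable (mk j y) (mk j (fun i => if i ∈ s then z i else y i)) := by
    induction s using Finset.induction_on with
    | empty => simp
    | insert k s hk ih =>
      refine ih.trans ((move' _ j k).trans ?_)
      rw [← mk_update k _ (z k)]
      refine (move' _ k j).trans ?_
      rw [show Function.update (fun i => if i ∈ s then z i else y i) k (z k) =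
        fun i => if i ∈ insert k s then z i else y i from ?_]
      funext i
      by_cases hi : i = k
      · subst hi; simp
      · simp [hi]
  refine (SimpleGraph.connected_iff _).2 ⟨fun u v => ?_, ⟨mk 0 0⟩⟩
  obtain ⟨j, y, rfl⟩ := exists_eq_mk u
  obtain ⟨k, z, rfl⟩ := exists_eq_mk v
  have := change y z j Finset.univ
  simp only [Finset.mem_univ, if_true] at this
  exact this.trans (move' z j k)

lemma two_pow_le_card_aStab {r : ℕ} [NeZero r] (hr : 3 ≤ r) (j : ZMod r) (ε : ZMod 2) :
    2 ^ r ≤ Nat.card (aStab (group r) (mk j 0) (mk (j + sgn r ε) 0)) := by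
  have : Finite (Vert r) := Subtype.finite
  let τ : (ZMod r → Bool) → ZMod r → Equiv.Perm (ZMod 3) :=
    fun b i => if b i then Equiv.neg _ else 1
  choose g hg using fun b : ZMod r → Bool => exists_acts (τ b) 1
  have hτ (b : ZMod r → Bool) (i : ZMod r) : τ b i 0 = 0 := by
    simp only [τ]; split_ifs <;> simp
  have hfix (b : ZMod r → Bool) (k : ZMod r) : g b (mk k 0) = mk k 0 := by
    rw [hg]
    exact mk_eq_mk.2 ⟨rfl, fun i _ => hτ b i⟩
  let F : (ZMod r → Bool) → aStab (group r) (mk j 0) (mk (j + sgn r ε) 0) := fun b =>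
    ⟨g b, ⟨⟨τ b, 1, 0, fun i ε => by simp, hg b⟩, hfix b _⟩, hfix b _⟩
  have hF : Function.Injective F := by
    intro b b' h
    have h' : g b = g b' := congrArg Subtype.val h
    have hne : (-1 : ZMod 3) ≠ 1 := by decide
    have sep (k i : ZMod r) (hik : i ≠ k) : b i = b' i := by
      have e : g b (mk k 1) = g b' (mk k 1) := by rw [h']
      rw [hg b, hg b'] at e
      have := (mk_eq_mk.1 e).2 i hik
      simp only [τ] at this
      cases hb : b i <;> cases hb' : b' i <;> simp [hb, hb', hne, hne.symm] at this ⊢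
    funext i
    refine sep (i + 1) i fun h => ?_
    exact sgn_ne_zero hr 0 (by simpa [sgn] using h)
  have := Nat.card_le_card_of_injective F hF
  simpa [Nat.card_eq_fintype_card, ZMod.card] using this

lemma le_card {r : ℕ} [NeZero r] : r ≤ Nat.card (Vert r) := by
  have : Finite (Vert r) := Subtype.finite
  have := Nat.card_le_card_of_injective (fun j : ZMod r => mk j 0)
    fun a b h => (mk_eq_mk.1 h).1
  simpa using this

lemma card_le {r : ℕ} [NeZero r] : Nat.card (Vert r) ≤ r * 3 ^ r := by
  have := Nat.card_le_card_of_surjective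
    (fun p : ZMod r × (ZMod r → ZMod 3) => mk p.1 p.2) fun v => by
      obtain ⟨j, y, rfl⟩ := exists_eq_mk v
      exact ⟨(j, y), rfl⟩
  simpa [Nat.card_eq_fintype_card, ZMod.card] using this

/-- Reduction of `ZMod 6` modulo `2`. -/
def red2 : ZMod 6 →+* ZMod 2 := ZMod.castHom (by norm_num) _

/-- Reduction of `ZMod 6` modulo `3`. -/
def red3 : ZMod 6 →+* ZMod 3 := ZMod.castHom (by norm_num) _

lemma red_injective : ∀ x y : ZMod 6, red2 x = red2 y → red3 x = red3 y → x = y := by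
  decide

lemma red_surjective : ∀ (a : ZMod 2) (b : ZMod 3), ∃ x, red2 x = a ∧ red3 x = b := by
  decide

lemma affine_perm : ∀ α : Equiv.Perm (ZMod 3), ∃ t s : ZMod 3, (s = 1 ∨ s = -1) ∧
    ∀ x, α x = t + s * x := by
  decide

lemma addLeft_mem_D6 (a : ZMod 6) : Equiv.addLeft a ∈ D6 := by
  have h : Equiv.addLeft (1 : ZMod 6) ∈ D6 := Subgroup.subset_closure (by simp)
  have hn (n : ℕ) : Equiv.addLeft (n : ZMod 6) ∈ D6 := by
    induction n with
    | zero =>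
      convert one_mem D6
      ext1 x
      simp
    | succ n ih =>
      convert mul_mem ih h
      ext1 x
      simp
  simpa using hn a.val

lemma mem_D6_iff (σ : Equiv.Perm (ZMod 6)) : σ ∈ D6 ↔
    ∃ (α : Equiv.Perm (ZMod 3)) (c : ZMod 2), ∀ x,
      red2 (σ x) = red2 x + c ∧ red3 (σ x) = α (red3 x) := by
  constructor
  · intro h
    induction h using Subgroup.closure_induction with
    | mem x hx =>
      rcases hx with rfl | rfl
      · exact ⟨Equiv.addLeft 1, 1, fun x => by simp [add_comm]⟩
      · exact ⟨Equiv.neg _, 0, fun x => by simp⟩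
    | one => exact ⟨1, 0, by simp⟩
    | mul f g _ _ hf hg =>
      obtain ⟨α, c, h⟩ := hf
      obtain ⟨β, d, h'⟩ := hg
      exact ⟨α * β, d + c, fun x => by simp [h, h', add_assoc]⟩
    | inv f _ hf =>
      obtain ⟨α, c, h⟩ := hf
      refine ⟨α⁻¹, c, fun x => ?_⟩
      have := h (f⁻¹ x)
      rw [show f (f⁻¹ x) = x from f.apply_symm_apply x] at this
      rw [this.1, this.2]
      simp [add_add_self]
  · rintro ⟨α, c, h⟩
    obtain ⟨t, s, hs, hα⟩ := affine_perm α
    obtain ⟨a, ha2, ha3⟩ := red_surjective c t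
    have hneg : Equiv.neg (ZMod 6) ∈ D6 := Subgroup.subset_closure (by simp)
    rcases hs with rfl | rfl
    · convert addLeft_mem_D6 a
      ext1 x
      apply red_injective <;> simp [h, hα, ha2, ha3, add_comm]
    · convert mul_mem (addLeft_mem_D6 a) hneg
      ext1 x
      apply red_injective <;> simp [h, hα, ha2, ha3, add_comm]

/-- The neighbours of `mk j y`, indexed by `ZMod 6`. -/
def nbr {r : ℕ} (j : ZMod r) (y : ZMod r → ZMod 3) (x : ZMod 6) : Vert r :=
  mk (j + sgn r (red2 x)) (Function.update y j (red3 x))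

lemma nbr_adj {r : ℕ} (hr : 3 ≤ r) (j : ZMod r) (y : ZMod r → ZMod 3) (x : ZMod 6) :
    (graph hr).Adj (mk j y) (nbr j y x) := by
  rw [← mk_update j y (red3 x)]
  exact graph_adj hr _ _ _

lemma nbr_eq_iff {r : ℕ} (hr : 3 ≤ r) {j : ZMod r} {y : ZMod r → ZMod 3} {x : ZMod 6}
    {ε : ZMod 2} {a : ZMod 3} :
    nbr j y x = mk (j + sgn r ε) (Function.update y j a) ↔ red2 x = ε ∧ red3 x = a := by
  constructor
  · intro h
    obtain ⟨h1, h2⟩ := mk_eq_mk.1 h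
    refine ⟨sgn_injective hr (add_left_cancel h1), ?_⟩
    have := h2 j fun e => sgn_ne_zero hr (red2 x) (by simpa using e.symm)
    simpa using this
  · rintro ⟨rfl, rfl⟩
    rfl

lemma nbr_bijective {r : ℕ} (hr : 3 ≤ r) (j : ZMod r) (y : ZMod r → ZMod 3) :
    Function.Bijective (fun x => (⟨nbr j y x, nbr_adj hr j y x⟩ :
      (graph hr).neighborSet (mk j y))) := by
  constructor
  · intro x x' h
    obtain ⟨h2, h3⟩ := (nbr_eq_iff hr).1 (congrArg Subtype.val h)
    exact red_injective _ _ h2 h3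
  · rintro ⟨w, k, ε, z, hu, rfl⟩
    obtain ⟨rfl, hz⟩ := mk_eq_mk.1 hu
    obtain ⟨x, rfl, hx⟩ := red_surjective ε (z j)
    refine ⟨x, Subtype.ext (mk_eq_mk.2 ⟨rfl, fun i _ => ?_⟩)⟩
    by_cases hi : i = j
    · subst hi; simp [hx]
    · simp [hi, hz]

lemma acts_nbr {r : ℕ} {g : Equiv.Perm (Vert r)} {τ : ZMod r → Equiv.Perm (ZMod 3)}
    {d : Equiv.Perm (ZMod r)} {c : ZMod 2} (hd : IsDihedral d c) (hg : Acts g τ d)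
    {j : ZMod r} {y : ZMod r → ZMod 3} (hv : g (mk j y) = mk j y) (x : ZMod 6) :
    g (nbr j y x) =
      mk (j + sgn r (red2 x + c)) (Function.update y j (τ j (red3 x))) := by
  rw [hg] at hv
  obtain ⟨hj, hy⟩ := mk_eq_mk.1 hv
  rw [nbr, hg, hd, hj]
  refine mk_eq_mk.2 ⟨rfl, fun i _ => ?_⟩
  by_cases hi : i = j
  · subst hi
    simp [d.symm_apply_eq.2 hj.symm]
  · have : d.symm i ≠ j := fun e => hi (by rw [← hj, ← e]; simp)
    rw [Function.update_of_ne hi, Function.update_of_ne this]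
    exact hy i (by rwa [hj])

lemma isLocally {r : ℕ} [NeZero r] (hr : 3 ≤ r) : IsLocally (graph hr) (group r) D6 := by
  intro v
  obtain ⟨j, y, rfl⟩ := exists_eq_mk v
  let E := Equiv.ofBijective _ (nbr_bijective hr j y)
  have hE (σ : Equiv.Perm (ZMod 6)) (g : Equiv.Perm (Vert r)) :
      (∀ w, (E (σ (E.symm w)) : Vert r) = g w) ↔ ∀ x, nbr j y (σ x) = g (nbr j y x) := by
    rw [E.symm.forall_congr_left]
    simp only [Equiv.symm_symm, Equiv.symm_apply_apply]
    rfl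
  refine ⟨E.symm, fun σ => ?_⟩
  simp only [Equiv.symm_symm, hE, mem_D6_iff]
  constructor
  · rintro ⟨α, c, h⟩
    obtain ⟨d, hd, hj⟩ := exists_dihedral j j c
    obtain ⟨g, hg⟩ := exists_acts
      (fun i => if i = j then α else Equiv.swap (y (d.symm i)) (y i)) d
    have hv : g (mk j y) = mk j y := by
      rw [hg, hj]
      exact mk_eq_mk.2 ⟨rfl, fun i hi => by simp [hi]⟩
    refine ⟨g, ⟨_, d, c, hd, hg⟩, hv, fun x => ?_⟩
    rw [acts_nbr hd hg hv, nbr_eq_iff hr]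
    simpa using h x
  · rintro ⟨g, ⟨τ, d, c, hd, hg⟩, hv, h⟩
    refine ⟨τ j, c, fun x => (nbr_eq_iff hr (j := j) (y := y)).1 ?_⟩
    rw [h, acts_nbr hd hg hv]

lemma isLocallyPair {r : ℕ} [NeZero r] (hr : 3 ≤ r) :
    IsLocallyPair (graph hr) (group r) D6 :=
  ⟨connected hr, group_le_aut hr, isArcTransitive hr, isLocally hr⟩

lemma eventually_rpow_le {α : ℝ} (h : α < Real.log 2 / Real.log 3) :
    ∀ᶠ r : ℕ in Filter.atTop, ((r : ℝ) * 3 ^ r) ^ α ≤ 2 ^ r := by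
  have hl3 : 0 < Real.log 3 := Real.log_pos (by norm_num)
  have h1 : α < 1 := h.trans ((div_lt_one hl3).2 (Real.log_lt_log (by norm_num) (by norm_num)))
  have h3 : (3 : ℝ) ^ α < 2 := by
    rw [← Real.lt_logb_iff_rpow_lt (by norm_num) (by norm_num)]
    exact h
  have h3' : (0 : ℝ) < 3 ^ α := by positivity
  have ht := tendsto_pow_const_div_const_pow_of_one_lt 1 ((one_lt_div h3').2 h3)
  filter_upwards [ht.eventually (gt_mem_nhds one_pos), Filter.eventually_ge_atTop 1] with r hr hr1
  have hr1' : (1 : ℝ) ≤ r := by exact_mod_cast hr1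
  rw [pow_one, div_pow, div_lt_one (by positivity), lt_div_iff₀ (by positivity)] at hr
  rw [Real.mul_rpow (by positivity) (by positivity), ← Real.rpow_natCast 3 r,
    ← Real.rpow_mul (by norm_num), mul_comm (r : ℝ) α, Real.rpow_mul (by norm_num),
    Real.rpow_natCast]
  refine le_trans ?_ hr.le
  gcongr
  exact (Real.rpow_le_rpow_of_exponent_le hr1' h1.le).trans_eq (Real.rpow_one _)

lemma fGraphUnrestrictive {α : ℝ} (h0 : 0 < α) (h : α < Real.log 2 / Real.log 3) :
    FGraphUnrestrictive D6 (fun n => (n : ℝ) ^ α) := by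
  intro n
  obtain ⟨r, hle, hn, hr⟩ := ((eventually_rpow_le h).and
    ((Filter.eventually_ge_atTop n).and (Filter.eventually_ge_atTop 3))).exists
  have : NeZero r := ⟨by omega⟩
  have : Finite (Vert r) := Subtype.finite
  let _ := Fintype.ofFinite (Vert r)
  refine ⟨Vert r, inferInstance, graph hr, group r, mk 0 0, mk (0 + sgn r 0) 0,
    isLocallyPair hr, ?_, graph_adj hr 0 0 0, ?_⟩
  · rw [← Nat.card_eq_fintype_card]
    exact hn.trans le_card
  · rw [← Nat.card_eq_fintype_card]
    have hc : (Nat.card (Vert r) : ℝ) ≤ r * 3 ^ r := by exact_mod_cast card_le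
    have hs : (2 : ℝ) ^ r ≤ Nat.card (aStab (group r) (mk 0 0) (mk (0 + sgn r 0) 0)) := by
      exact_mod_cast two_pow_le_card_aStab hr 0 0
    exact ((Real.rpow_le_rpow (by positivity) hc h0.le).trans hle).trans hs

end HexWreath

/-- The dihedral group `D₆` of order 12 in its natural action on 6 points is
`n^α`-graph-unrestrictive for every `0 < α < log 2 / log 3`; in particular it is
Pol-graph-unrestrictive. -/
theorem statement15 :
    (∀ α : ℝ, 0 < α → α < Real.log 2 / Real.log 3 →
      FGraphUnrestrictive D6 (fun n => (n : ℝ) ^ α)) ∧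
    ∃ α : ℝ, 0 < α ∧ FGraphUnrestrictive D6 (fun n => (n : ℝ) ^ α) := by
  have hpos : 0 < Real.log 2 / Real.log 3 :=
    div_pos (Real.log_pos (by norm_num)) (Real.log_pos (by norm_num))
  exact ⟨fun α h0 h => HexWreath.fGraphUnrestrictive h0 h, _, half_pos hpos,
    HexWreath.fGraphUnrestrictive (half_pos hpos) (half_lt_self hpos)⟩
end
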